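/- Let k ≥ 2 be an integer. There exists N such that for every integer n ≥ N satisfying n ≡ 1 (mod k(k−1)) or n ≡ k (mod k(k−1)), the edge set of the complete graph K_n can be partitioned into edge sets of k-cliques, i.e., K_n contains a perfect k-clique packing. -/

import Mathlib

open Finset
open scoped Classical

/-- The edges of `G` spanned by the vertex set `s` (for a clique `s`, these are
the edges of the clique). -/
noncomputable def cliqueEdges {V : Type*} [Fintype V] [DecidableEq V]
    (G : SimpleGraph V) (s : Finset V) : Finset (Sym2 V) :=
  G.edgeFinset.filter (fun e => ∀ v ∈ e, v ∈ s)

/-- `HasGDD L g`: the points of `V`, split into groups by `g`, carry a group divisible design with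
block sizes in `L`; that is, the complete multipartite graph whose parts are the fibres of `g`
decomposes into cliques whose sizes lie in `L`. -/
def HasGDD (L : Set ℕ) {V I : Type} (g : V → I) : Prop :=
  ∃ (ι : Type) (B : ι → Finset V), (∀ i, (B i).card ∈ L) ∧ (∀ i, Set.InjOn g (B i)) ∧
    ∀ x y, g x ≠ g y → ∃! i, x ∈ B i ∧ y ∈ B i

namespace HasGDD

variable {K L : Set ℕ} {V V' W I I' J : Type}

theorem of_equiv {g : V → I} {g' : V' → I'} (h : HasGDD L g) (e : V' ≃ V)
    (he : ∀ x y, g' x = g' y ↔ g (e x) = g (e y)) : HasGDD L g' := by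
  obtain ⟨ι, B, h1, h2, h3⟩ := h
  refine ⟨ι, fun i => (B i).map e.symm.toEmbedding, fun i => by simpa using h1 i, ?_, ?_⟩
  · intro i x hx y hy hxy
    simp only [coe_map, Equiv.coe_toEmbedding, Set.mem_image, SetLike.mem_coe] at hx hy
    obtain ⟨a, ha, rfl⟩ := hx
    obtain ⟨b, hb, rfl⟩ := hy
    rw [he] at hxy
    simp only [Equiv.apply_symm_apply] at hxy
    rw [h2 i ha hb hxy]
  · intro x y hxy
    have := h3 (e x) (e y) (fun h => hxy ((he x y).2 h))
    simpa [Finset.mem_map_equiv] using this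

/-- Wilson's fundamental construction with constant weight. -/
theorem weight {g : V → I} (h : HasGDD K g)
    (hK : ∀ κ ∈ K, HasGDD L (Prod.fst : Fin κ × W → Fin κ)) :
    HasGDD L (fun p : V × W => g p.1) := by
  obtain ⟨ι, B, h1, h2, h3⟩ := h
  have key : ∀ i, ∃ (ι' : Type) (B' : ι' → Finset (B i × W)), (∀ j, (B' j).card ∈ L) ∧
      (∀ j, Set.InjOn (Prod.fst : B i × W → B i) (B' j)) ∧
      ∀ x y : B i × W, x.1 ≠ y.1 → ∃! j, x ∈ B' j ∧ y ∈ B' j := by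
    intro i
    have e : B i ≃ Fin (B i).card := (B i).equivFin
    exact (hK _ (h1 i)).of_equiv (g' := (Prod.fst : B i × W → B i))
      (e.prodCongr (Equiv.refl W)) (fun x y => by simp)
  choose ι' B' k1 k2 k3 using key
  let f : ∀ i, B i × W ↪ V × W := fun i =>
    ⟨fun p => (p.1, p.2), fun p q hpq => by
      simp only [Prod.mk.injEq] at hpq
      exact Prod.ext (Subtype.ext hpq.1) hpq.2⟩
  have hf : ∀ i (s : Finset (B i × W)) (x : V × W),
      x ∈ s.map (f i) ↔ ∃ hx : x.1 ∈ B i, ((⟨x.1, hx⟩, x.2) : B i × W) ∈ s := by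
    intro i s x
    simp only [Finset.mem_map]
    constructor
    · rintro ⟨a, ha, rfl⟩
      exact ⟨a.1.2, ha⟩
    · rintro ⟨hx, hs⟩
      exact ⟨_, hs, rfl⟩
  refine ⟨Σ i, ι' i, fun j => (B' j.1 j.2).map (f j.1), fun j => by simpa using k1 j.1 j.2, ?_, ?_⟩
  · rintro ⟨i, j⟩ x hx y hy hxy
    rw [SetLike.mem_coe, hf] at hx hy
    obtain ⟨hx, hx'⟩ := hx
    obtain ⟨hy, hy'⟩ := hy
    have h4 : x.1 = y.1 := h2 i hx hy hxy
    have h5 := k2 i j hx' hy' (Subtype.ext h4)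
    simp only [Prod.mk.injEq, Subtype.mk.injEq] at h5
    exact Prod.ext h5.1 h5.2
  · intro x y hxy
    obtain ⟨i, ⟨hx, hy⟩, hu⟩ := h3 x.1 y.1 hxy
    obtain ⟨j, ⟨hx', hy'⟩, hu'⟩ := k3 i (⟨x.1, hx⟩, x.2) (⟨y.1, hy⟩, y.2)
      (fun h => hxy (congrArg (fun z : B i => g z) h))
    refine ⟨⟨i, j⟩, ⟨(hf _ _ _).2 ⟨hx, hx'⟩, (hf _ _ _).2 ⟨hy, hy'⟩⟩, ?_⟩
    rintro ⟨i', j'⟩ ⟨ha, hb⟩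
    rw [hf] at ha hb
    obtain ⟨ha, ha'⟩ := ha
    obtain ⟨hb, hb'⟩ := hb
    obtain rfl := hu i' ⟨ha, hb⟩
    obtain rfl := hu' j' ⟨ha', hb'⟩
    rfl

/-- Filling in the groups of a design with designs having a finer group partition. -/
theorem fill {g : V → I} {h : V → J} (hg : HasGDD L g) (hgh : ∀ x y, h x = h y → g x = g y)
    (hfill : ∀ i, HasGDD L (fun x : {x // g x = i} => h x)) : HasGDD L h := by
  obtain ⟨ι, B, h1, h2, h3⟩ := hg
  choose ι' B' k1 k2 k3 using hfill
  refine ⟨ι ⊕ Σ i, ι' i,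
    Sum.elim B (fun j => (B' j.1 j.2).map (Function.Embedding.subtype _)), ?_, ?_, ?_⟩
  · rintro (i | j)
    · exact h1 i
    · simpa using k1 j.1 j.2
  · rintro (i | ⟨i, j⟩) x hx y hy hxy
    · exact h2 i hx hy (hgh _ _ hxy)
    · simp only [Sum.elim_inr, coe_map, Set.mem_image, SetLike.mem_coe] at hx hy
      obtain ⟨a, ha, rfl⟩ := hx
      obtain ⟨b, hb, rfl⟩ := hy
      exact congrArg _ (k2 i j ha hb hxy)
  · intro x y hxy
    by_cases hg : g x = g y
    · obtain ⟨j, ⟨hj1, hj2⟩, hu⟩ := k3 (g y) ⟨x, hg⟩ ⟨y, rfl⟩ hxy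
      refine ⟨Sum.inr ⟨g y, j⟩, ⟨?_, ?_⟩, ?_⟩
      · exact Finset.mem_map.2 ⟨_, hj1, rfl⟩
      · exact Finset.mem_map.2 ⟨_, hj2, rfl⟩
      · rintro (i | ⟨i, j'⟩) ⟨ha, hb⟩
        · exact absurd (congrArg h (h2 i ha hb hg)) hxy
        · simp only [Sum.elim_inr, Finset.mem_map] at ha hb
          obtain ⟨a, ha, rfl⟩ := ha
          obtain ⟨⟨b, rfl⟩, hb, hb'⟩ := hb
          subst hb'
          obtain rfl := hu j' ⟨ha, hb⟩
          rfl
    · obtain ⟨i, hi, hu⟩ := h3 x y hg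
      refine ⟨Sum.inl i, hi, ?_⟩
      rintro (i' | ⟨i, j'⟩) ⟨ha, hb⟩
      · rw [hu i' ⟨ha, hb⟩]
      · simp only [Sum.elim_inr, Finset.mem_map] at ha hb
        obtain ⟨a, ha, rfl⟩ := ha
        obtain ⟨b, hb, rfl⟩ := hb
        exact absurd (a.2.trans b.2.symm) hg

/-- Deleting points from a design. -/
theorem comap {g : V → I} (h : HasGDD K g) (f : V' ↪ V)
    (hf : ∀ b : Finset V, b.card ∈ K → Set.InjOn g b →
      (b.preimage f f.injective.injOn).card ∈ L) : HasGDD L (fun x => g (f x)) := by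
  obtain ⟨ι, B, h1, h2, h3⟩ := h
  refine ⟨ι, fun i => (B i).preimage f f.injective.injOn, fun i => hf _ (h1 i) (h2 i), ?_, ?_⟩
  · intro i x hx y hy hxy
    simp only [coe_preimage, Set.mem_preimage] at hx hy
    exact f.injective (h2 i hx hy hxy)
  · intro x y hxy
    simpa using h3 _ _ hxy

theorem of_card_mem [Fintype V] {h : V → J} (hh : Function.Injective h)
    (hV : Fintype.card V ∈ L) : HasGDD L h :=
  ⟨Unit, fun _ => Finset.univ, fun _ => hV, fun _ => hh.injOn, fun _ _ _ => ⟨(), by simp⟩⟩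

theorem of_const {h : V → J} (hh : ∀ x y, h x = h y) : HasGDD L h :=
  ⟨Empty, Empty.elim, fun i => i.elim, fun i => i.elim, fun x y hxy => (hxy (hh x y)).elim⟩

end HasGDD

/-- `BlowUp w m t`: the balanced complete `m`-partite graph with parts of size `t` decomposes into
`w`-cliques. -/
def BlowUp (w m t : ℕ) : Prop := HasGDD {w} (Prod.fst : Fin m × Fin t → Fin m)

namespace BlowUp

variable {w m t u E s a b c : ℕ}

theorem zero (w t : ℕ) : BlowUp w 0 t := HasGDD.of_const fun x => x.1.elim0

theorem one (w t : ℕ) : BlowUp w 1 t := HasGDD.of_const fun _ _ => Subsingleton.elim _ _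

theorem self_one (w : ℕ) : BlowUp w w 1 :=
  HasGDD.of_card_mem (fun x y h => Prod.ext h (Subsingleton.elim _ _)) (by simp)

theorem iff_of_card {V I : Type} [Fintype V] [Fintype I] {g : V → I} {L : Set ℕ}
    (hI : Fintype.card I = m) (hg : ∀ i, Fintype.card {x // g x = i} = t) :
    HasGDD L (Prod.fst : Fin m × Fin t → Fin m) ↔ HasGDD L g := by
  let e : V ≃ Fin m × Fin t :=
    (Equiv.sigmaFiberEquiv g).symm.trans
      ((Equiv.sigmaCongrRight fun i => Fintype.equivFinOfCardEq (hg i)).trans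
        ((Equiv.sigmaEquivProd I (Fin t)).trans
          ((Fintype.equivFinOfCardEq hI).prodCongr (Equiv.refl _))))
  have he : ∀ x y, g x = g y ↔ (e x).1 = (e y).1 := by
    intro x y
    simp [e, Equiv.sigmaFiberEquiv]
  exact ⟨fun h => h.of_equiv e he, fun h => h.of_equiv e.symm fun x y => by simp [he]⟩

theorem mul (h : BlowUp w m a) (hw : BlowUp w w b) : BlowUp w m (a * b) := by
  have := HasGDD.weight (W := Fin b) (L := {w}) h (by rintro κ rfl; exact hw)
  refine this.of_equiv (((Equiv.refl (Fin m)).prodCongr finProdFinEquiv.symm).trans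
    (Equiv.prodAssoc _ _ _).symm) fun x y => ?_
  simp

/-- Filling in the groups of a uniform design. -/
theorem fill (h : BlowUp w a (b * c)) (hb : BlowUp w b c) : BlowUp w (a * b) c := by
  have h1 : HasGDD {w} (fun p : Fin a × (Fin b × Fin c) => p.1) :=
    h.of_equiv ((Equiv.refl (Fin a)).prodCongr finProdFinEquiv) fun x y => by simp
  have h2 : HasGDD {w} (fun p : Fin a × (Fin b × Fin c) => (p.1, p.2.1)) := by
    refine h1.fill (by simp) fun i => ?_
    refine hb.of_equiv (g' := fun x : {x : Fin a × (Fin b × Fin c) // x.1 = i} =>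
      (x.1.1, x.1.2.1)) (⟨fun x => x.1.2, fun y => ⟨(i, y), rfl⟩, ?_, ?_⟩) ?_
    · rintro ⟨⟨x, y⟩, rfl⟩; rfl
    · intro y; rfl
    · rintro ⟨⟨x, y⟩, rfl⟩ ⟨⟨x', y'⟩, hx'⟩
      simp only at hx'
      simp [hx']
  refine h2.of_equiv (((finProdFinEquiv.symm).prodCongr (Equiv.refl (Fin c))).trans
    (Equiv.prodAssoc _ _ _)) fun x y => ?_
  rw [← finProdFinEquiv.symm.injective.eq_iff (a := x.1)]
  simp [Prod.ext_iff]

/-- The set of `m` with `BlowUp w m t` is closed under pairwise balanced designs. -/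
theorem of_pbd {K : Set ℕ} {V : Type} [Fintype V] (hK : ∀ κ ∈ K, BlowUp w κ t)
    (h : HasGDD K (id : V → V)) : BlowUp w (Fintype.card V) t := by
  refine (HasGDD.weight (L := {w}) h hK).of_equiv
    ((Fintype.equivFin V).symm.prodCongr (Equiv.refl (Fin t))) fun x y => ?_
  simp

/-- Truncating one group of a uniform design and filling in all groups. -/
theorem truncate (h : BlowUp (u + 1) (m + 1) E) (hs : s ≤ E) (hu : BlowUp w u t)
    (hu1 : BlowUp w (u + 1) t) (hE : BlowUp w E t) (hs' : BlowUp w s t) :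
    BlowUp w (m * E + s) t := by
  let f : (Fin m × Fin E) ⊕ Fin s ↪ Fin (m + 1) × Fin E :=
    ⟨Sum.elim (fun p => (p.1.castSucc, p.2)) (fun j => (Fin.last m, j.castLE hs)), by
      rintro (⟨x, y⟩ | x) (⟨x', y'⟩ | x') hx
      · simpa using hx
      · simp [Fin.castSucc_ne_last] at hx
      · simp [(Fin.castSucc_ne_last _).symm] at hx
      · simpa using hx⟩
  let K : Set ℕ := {u, u + 1, E, s}
  have h1 : HasGDD K (fun x => (f x).1) := by
    refine HasGDD.comap h f fun b hb hbi => ?_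
    have hle : (b.preimage f f.injective.injOn).card ≤ b.card := by
      rw [← Finset.card_map f]
      refine Finset.card_le_card fun x hx => ?_
      simp only [Finset.mem_map, mem_preimage] at hx
      obtain ⟨a, ha, rfl⟩ := hx
      exact ha
    have hge : b.card ≤ (b.preimage f f.injective.injOn).card + 1 := by
      rw [← Finset.card_map f]
      have : b ⊆ ((b.preimage f f.injective.injOn).map f) ∪
          (b.filter fun x => x.1 = Fin.last m) := by
        intro x hx
        rw [Finset.mem_union]
        by_cases hl : x.1 = Fin.last m
        · exact Or.inr (by simp [hx, hl])
        · left
          obtain ⟨i, hi⟩ := Fin.exists_castSucc_eq.2 hl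
          have hfx : f (Sum.inl (i, x.2)) = x := Prod.ext hi rfl
          exact Finset.mem_map.2 ⟨_, Finset.mem_preimage.2 (by rwa [hfx]), hfx⟩
      refine (Finset.card_le_card this).trans ((Finset.card_union_le _ _).trans ?_)
      have : (b.filter fun x => x.1 = Fin.last m).card ≤ 1 := by
        refine Finset.card_le_one.2 fun x hx y hy => ?_
        simp only [Finset.mem_filter] at hx hy
        exact hbi hx.1 hy.1 (hx.2.trans hy.2.symm)
      omega
    rw [Set.mem_singleton_iff] at hb
    have : (b.preimage f f.injective.injOn).card = u ∨
        (b.preimage f f.injective.injOn).card = u + 1 := by omega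
    rcases this with h | h <;> simp [K, h]
  have h2 : HasGDD K (id : (Fin m × Fin E) ⊕ Fin s → _) := by
    refine h1.fill (fun x y hxy => by rw [id, id] at hxy; rw [hxy]) fun i => ?_
    refine HasGDD.of_card_mem Subtype.val_injective ?_
    rcases Fin.eq_castSucc_or_eq_last i with ⟨i, rfl⟩ | rfl
    · have : Fintype.card {x // (f x).1 = i.castSucc} = E := by
        refine (Fintype.card_congr (Equiv.ofBijective
          (fun j : Fin E => (⟨Sum.inl (i, j), rfl⟩ : {x // (f x).1 = i.castSucc}))
          ⟨?_, ?_⟩)).symm.trans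
            (Fintype.card_fin _)
        · intro j j' h
          exact (Prod.ext_iff.1 (Sum.inl_injective (congrArg Subtype.val h))).2
        · rintro ⟨(⟨x, y⟩ | x), hx⟩
          · obtain rfl := Fin.castSucc_injective _ hx
            exact ⟨y, rfl⟩
          · exact absurd hx.symm (Fin.castSucc_ne_last i)
      rw [this]
      simp [K]
    · have : Fintype.card {x // (f x).1 = Fin.last m} = s := by
        refine (Fintype.card_congr (Equiv.ofBijective
          (fun j : Fin s => (⟨Sum.inr j, rfl⟩ : {x // (f x).1 = Fin.last m})) ⟨?_, ?_⟩)).symm.trans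
            (Fintype.card_fin _)
        · intro j j' h
          exact Sum.inr_injective (congrArg Subtype.val h)
        · rintro ⟨(⟨x, y⟩ | x), hx⟩
          · exact absurd hx (Fin.castSucc_ne_last x)
          · exact ⟨x, rfl⟩
      rw [this]
      simp [K]
  have h3 := of_pbd (w := w) (t := t) (K := K) ?_ h2
  · simpa using h3
  · rintro κ (rfl | rfl | rfl | rfl) <;> assumption

end BlowUp

namespace BlowUp

variable {w m t a b : ℕ}

/-- A transversal design from ring elements with pairwise invertible differences. -/
theorem of_ring {A : Type} [CommRing A] [Fintype A] (hA : Fintype.card A = t) (a : Fin w → A)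
    (ha : ∀ i j, i ≠ j → IsUnit (a i - a j)) : BlowUp w w t := by
  have key : HasGDD {w} (Prod.fst : Fin w × A → Fin w) := by
    have hmem : ∀ (c : A × A) (x : Fin w × A),
        x ∈ Finset.univ.image (fun i : Fin w => (i, a i * c.1 + c.2)) ↔
          a x.1 * c.1 + c.2 = x.2 := by
      rintro c ⟨i, α⟩
      simp [Prod.ext_iff]
    refine ⟨A × A, fun c => Finset.univ.image (fun i : Fin w => (i, a i * c.1 + c.2)), ?_, ?_, ?_⟩
    · intro c
      rw [Finset.card_image_of_injective _ fun i j h => (Prod.ext_iff.1 h).1]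
      simp
    · intro c x hx y hy hxy
      rw [SetLike.mem_coe, hmem] at hx hy
      exact Prod.ext hxy (by rw [← hx, ← hy, hxy])
    · rintro ⟨i, α⟩ ⟨j, β⟩ hij
      obtain ⟨v, hv⟩ := ha i j hij
      simp only [hmem]
      refine ⟨(↑v⁻¹ * (α - β), α - a i * (↑v⁻¹ * (α - β))), ⟨by ring, ?_⟩, ?_⟩
      · have : (a i - a j) * (↑v⁻¹ * (α - β)) = α - β := by
          rw [← hv, ← mul_assoc, Units.mul_inv, one_mul]
        linear_combination -this
      · rintro ⟨c, z⟩ ⟨h1, h2⟩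
        simp only at h1 h2
        have h3 : c = ↑v⁻¹ * (α - β) := by
          rw [← h1, ← h2]
          have : a i * c + z - (a j * c + z) = v * c := by rw [hv]; ring
          rw [this, ← mul_assoc, Units.inv_mul, one_mul]
        rw [← h3, ← h1]
        simp
  exact key.of_equiv ((Equiv.refl _).prodCongr (Fintype.equivFinOfCardEq hA).symm)
    fun x y => by simp

theorem of_field {F : Type} [Field F] [Fintype F] (hw : w ≤ Fintype.card F) :
    BlowUp w w (Fintype.card F) := by
  obtain ⟨f⟩ : Nonempty (Fin w ↪ F) := Function.Embedding.nonempty_of_card_le (by simpa using hw)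
  exact of_ring rfl f fun i j hij => (sub_ne_zero.2 (f.injective.ne hij)).isUnit

theorem of_prime_pow {p d : ℕ} (hp : p.Prime) (hd : d ≠ 0) (hw : w ≤ p ^ d) :
    BlowUp w w (p ^ d) := by
  have : Fact p.Prime := ⟨hp⟩
  have : Fintype (GaloisField p d) := Fintype.ofFinite _
  have hc : Fintype.card (GaloisField p d) = p ^ d := by
    rw [← Nat.card_eq_fintype_card, GaloisField.card p d hd]
  rw [← hc] at hw ⊢
  exact of_field hw

theorem of_coprime (ht : 0 < t) (h : t.Coprime w.factorial) : BlowUp w w t := by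
  have : NeZero t := ⟨ht.ne'⟩
  have key : ∀ i j : Fin w, j < i → IsUnit (((i : ℕ) : ZMod t) - ((j : ℕ) : ZMod t)) := by
    intro i j hij
    rw [← Nat.cast_sub (by exact hij.le), ZMod.isUnit_iff_coprime]
    refine (Nat.Coprime.coprime_dvd_right (Nat.dvd_factorial ?_ ?_) h).symm
    · exact Nat.sub_pos_of_lt hij
    · have := i.2
      omega
  refine of_ring (ZMod.card t) (fun i => ((i : ℕ) : ZMod t)) fun i j hij => ?_
  rcases lt_or_gt_of_ne hij with h | h
  · rw [← neg_sub]
    exact (key j i h).neg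
  · exact key i j h

theorem of_pow (w : ℕ) {N : ℕ} (hN : N ≠ 0) : BlowUp w w (N ^ w) := by
  rcases Nat.eq_zero_or_pos w with rfl | hw
  · exact zero _ _
  induction N using Nat.recOnMul with
  | zero => exact absurd rfl hN
  | one => rw [one_pow]; exact self_one w
  | prime p hp =>
    exact of_prime_pow hp hw.ne' ((Nat.lt_two_pow_self).le.trans (Nat.pow_le_pow_left hp.two_le w))
  | mul a b iha ihb =>
    rw [mul_pow]
    exact (iha (left_ne_zero_of_mul hN)).mul (ihb (right_ne_zero_of_mul hN))

end BlowUp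

/-- The points of `A` at colour `g` from `x`. -/
noncomputable def colourNbhd {F G : Type} [Field F] (c : F → G) (A : Finset F) (g : G)
    (x : F) : Finset F :=
  A.filter fun v => v ≠ x ∧ c (v - x) = g

theorem sum_card_colourNbhd {F G : Type} [Field F] [Fintype F] [Fintype G] {c : F → G}
    (A : Finset F) :
    ∑ g, ∑ x, (#(colourNbhd c A g x) : ℤ) = #A * ((Fintype.card F : ℤ) - 1) := by
  rw [Finset.sum_comm]
  have h1 : ∀ x, ∑ g, (#(colourNbhd c A g x) : ℤ) = #(A.filter fun v => v ≠ x) := by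
    intro x
    rw [← Nat.cast_sum, Finset.card_eq_sum_card_fiberwise (f := fun v => c (v - x)) (t := univ)
      (fun _ _ => Finset.mem_coe.2 (Finset.mem_univ _))]
    simp only [colourNbhd, Finset.filter_filter]
  simp only [h1, Finset.card_filter, Nat.cast_sum]
  rw [Finset.sum_comm]
  have h2 : ∀ v : F, ∑ x : F, (((if v ≠ x then 1 else 0 : ℕ)) : ℤ) = (Fintype.card F : ℤ) - 1 := by
    intro v
    rw [← Nat.cast_sum, ← Finset.card_filter, Finset.filter_ne, Finset.card_erase_of_mem
      (Finset.mem_univ _), Finset.card_univ, Nat.cast_pred Fintype.card_pos]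
  rw [Finset.sum_congr rfl fun v _ => h2 v, Finset.sum_const, nsmul_eq_mul]

section Cyclotomy

variable {F G : Type} [Field F] [Fintype F] [CommGroup G] {c : F → G} {e : ℕ}

/-- For distinct `v, v'`, few points `x` see `v` and `v'` in the same colour. -/
theorem card_same_colour_le (hc : ∀ x y, x ≠ 0 → y ≠ 0 → c (x * y) = c x * c y)
    (he : #{x : F | x ≠ 0 ∧ c x = 1} ≤ e) {v v' : F} (hv : v ≠ v') :
    #{x : F | v ≠ x ∧ v' ≠ x ∧ c (v - x) = c (v' - x)} + 1 ≤ e := by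
  have h1 : c 1 = 1 := by
    have := hc 1 1 one_ne_zero one_ne_zero
    rw [mul_one] at this
    exact left_eq_mul.1 this
  refine le_trans ?_ he
  have hone : (1 : F) ∈ ({x : F | x ≠ 0 ∧ c x = 1} : Finset F) := by simp [h1]
  rw [← Finset.card_erase_add_one hone]
  refine Nat.add_le_add_right (Finset.card_le_card_of_injOn (fun x => (v - x) / (v' - x)) ?_ ?_) 1
  · intro x hx
    simp only [coe_filter, Finset.mem_univ, true_and, Set.mem_ofPred_eq] at hx
    obtain ⟨hx1, hx2, hx3⟩ := hx
    have hx1' := sub_ne_zero.2 hx1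
    have hx2' := sub_ne_zero.2 hx2
    have hne : (v - x) / (v' - x) ≠ 0 := div_ne_zero hx1' hx2'
    have h3 := hc _ _ hne hx2'
    rw [div_mul_cancel₀ _ hx2', hx3] at h3
    simp only [SetLike.mem_coe, Finset.mem_erase, Finset.mem_filter, Finset.mem_univ, true_and]
    refine ⟨fun h => hv ?_, hne, right_eq_mul.1 h3⟩
    rw [div_eq_one_iff_eq hx2'] at h
    exact sub_left_injective h
  · intro x hx y hy hxy
    simp only [coe_filter, Finset.mem_univ, true_and, Set.mem_ofPred_eq] at hx hy
    have hx2' := sub_ne_zero.2 hx.2.1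
    have hy2' := sub_ne_zero.2 hy.2.1
    simp only at hxy
    rw [div_eq_div_iff hx2' hy2'] at hxy
    have : (v - v') * (x - y) = 0 := by linear_combination hxy
    rcases mul_eq_zero.1 this with h | h
    · exact absurd (sub_eq_zero.1 h) hv
    · exact sub_eq_zero.1 h

variable [Fintype G]

theorem sum_sq_card_colourNbhd_le (hc : ∀ x y, x ≠ 0 → y ≠ 0 → c (x * y) = c x * c y)
    (he : #{x : F | x ≠ 0 ∧ c x = 1} ≤ e) (A : Finset F) :
    ∑ g, ∑ x, (#(colourNbhd c A g x) : ℤ) ^ 2 ≤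
      #A * ((Fintype.card F : ℤ) - 1) + ((#A : ℤ) ^ 2 - #A) * (e - 1) := by
  have h1 : ∀ g x, (#(colourNbhd c A g x) : ℤ) ^ 2 = ∑ v ∈ A, ∑ v' ∈ A,
      if v ≠ x ∧ v' ≠ x ∧ c (v - x) = g ∧ c (v' - x) = g then 1 else 0 := by
    intro g x
    rw [colourNbhd, Finset.card_filter, Nat.cast_sum, sq, Finset.sum_mul_sum]
    refine Finset.sum_congr rfl fun v _ => Finset.sum_congr rfl fun v' _ => ?_
    by_cases h1 : v ≠ x <;> by_cases h2 : v' ≠ x <;> by_cases h3 : c (v - x) = g <;>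
      by_cases h4 : c (v' - x) = g <;> simp [h1, h2, h3, h4]
  have h2 : ∑ g, ∑ x, (#(colourNbhd c A g x) : ℤ) ^ 2 = ∑ v ∈ A, ∑ v' ∈ A,
      (#{x : F | v ≠ x ∧ v' ≠ x ∧ c (v - x) = c (v' - x)} : ℤ) := by
    simp only [h1]
    rw [Finset.sum_comm]
    have h3 : ∀ x, ∑ g : G, ∑ v ∈ A, ∑ v' ∈ A,
        (if v ≠ x ∧ v' ≠ x ∧ c (v - x) = g ∧ c (v' - x) = g then (1 : ℤ) else 0) =
        ∑ v ∈ A, ∑ v' ∈ A, if v ≠ x ∧ v' ≠ x ∧ c (v - x) = c (v' - x) then (1 : ℤ) else 0 := by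
      intro x
      rw [Finset.sum_comm]
      refine Finset.sum_congr rfl fun v _ => ?_
      rw [Finset.sum_comm]
      refine Finset.sum_congr rfl fun v' _ => ?_
      rw [Finset.sum_eq_single (c (v - x))]
      · simp [eq_comm]
      · intro g _ hg
        simp [Ne.symm hg]
      · simp
    simp only [h3]
    rw [Finset.sum_comm]
    refine Finset.sum_congr rfl fun v _ => ?_
    rw [Finset.sum_comm]
    refine Finset.sum_congr rfl fun v' _ => ?_
    rw [Finset.card_filter]
    simp
  rw [h2]
  have h4 : ∀ v ∈ A, ∑ v' ∈ A, (#{x : F | v ≠ x ∧ v' ≠ x ∧ c (v - x) = c (v' - x)} : ℤ) ≤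
      ((Fintype.card F : ℤ) - 1) + ((#A : ℤ) - 1) * (e - 1) := by
    intro v hv
    rw [← Finset.add_sum_erase _ _ hv]
    refine add_le_add (le_of_eq ?_) ?_
    · have : ({x : F | v ≠ x ∧ v ≠ x ∧ c (v - x) = c (v - x)} : Finset F) = univ.erase v := by
        ext x; simp [eq_comm]
      rw [this, Finset.card_erase_of_mem (Finset.mem_univ _), Finset.card_univ,
        Nat.cast_pred Fintype.card_pos]
    · refine (Finset.sum_le_card_nsmul _ _ ((e : ℤ) - 1) fun v' hv' => ?_).trans (le_of_eq ?_)
      · have := card_same_colour_le hc he (Finset.ne_of_mem_erase hv').symm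
        linarith [(Nat.cast_le (α := ℤ)).2 this, Nat.cast_succ (R := ℤ)
          #{x : F | v ≠ x ∧ v' ≠ x ∧ c (v - x) = c (v' - x)}]
      · rw [Finset.card_erase_of_mem hv, nsmul_eq_mul, Nat.cast_pred (Finset.card_pos.2 ⟨v, hv⟩)]
  refine (Finset.sum_le_sum h4).trans (le_of_eq ?_)
  rw [Finset.sum_const, nsmul_eq_mul]
  ring

/-- Few points have an abnormally small neighbourhood of a given colour. -/
theorem card_small_colourNbhd_mul_le (hc : ∀ x y, x ≠ 0 → y ≠ 0 → c (x * y) = c x * c y)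
    (he : #{x : F | x ≠ 0 ∧ c x = 1} ≤ e) (hF : Fintype.card F = Fintype.card G * e + 1)
    (A : Finset F) (g : G) :
    #{x : F | 2 * Fintype.card G * #(colourNbhd c A g x) < #A} * #A ≤
      4 * Fintype.card G ^ 2 * Fintype.card F := by
  set m := Fintype.card G with hm
  set q := Fintype.card F with hq
  have hm1 : 1 ≤ m := Fintype.card_pos
  rcases Nat.eq_zero_or_pos #A with hA | hA
  · simp [hA]
  have key : ∑ g : G, ∑ x : F, ((m : ℤ) * #(colourNbhd c A g x) - #A) ^ 2 ≤
      (m : ℤ) ^ 2 * q * #A := by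
    have : ∀ (g : G) (x : F), ((m : ℤ) * #(colourNbhd c A g x) - #A) ^ 2 =
        (m : ℤ) ^ 2 * (#(colourNbhd c A g x) : ℤ) ^ 2 -
          2 * m * #A * #(colourNbhd c A g x) + (#A : ℤ) ^ 2 := by
      intro g x; ring
    simp only [this, Finset.sum_add_distrib, Finset.sum_sub_distrib, ← Finset.mul_sum]
    rw [sum_card_colourNbhd]
    have h2 := mul_le_mul_of_nonneg_left (sum_sq_card_colourNbhd_le hc he A) (sq_nonneg (m : ℤ))
    simp only [Finset.sum_const, Finset.card_univ, nsmul_eq_mul, ← hm, ← hq]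
    rw [← hq] at h2
    have hF' : (q : ℤ) = m * e + 1 := by exact_mod_cast hF
    rw [hF'] at h2 ⊢
    have h5 : (0 : ℤ) ≤ (m - 1) * m * (#A : ℤ) ^ 2 := by
      have : (0 : ℤ) ≤ m - 1 := by linarith [(Nat.cast_le (α := ℤ)).2 hm1, Nat.cast_one (R := ℤ)]
      positivity
    have h6 : (0 : ℤ) ≤ (m : ℤ) ^ 2 * e * #A := by positivity
    nlinarith [h2, h5, h6]
  have h1 : ∑ x : F, ((m : ℤ) * #(colourNbhd c A g x) - #A) ^ 2 ≤ (m : ℤ) ^ 2 * q * #A :=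
    (Finset.single_le_sum (f := fun g => ∑ x : F, ((m : ℤ) * #(colourNbhd c A g x) - #A) ^ 2)
      (fun g _ => Finset.sum_nonneg fun x _ => sq_nonneg _) (Finset.mem_univ g)).trans key
  have h2 : (#{x : F | 2 * m * #(colourNbhd c A g x) < #A} : ℤ) * (#A : ℤ) ^ 2 ≤
      ∑ x : F, 4 * ((m : ℤ) * #(colourNbhd c A g x) - #A) ^ 2 := by
    rw [← nsmul_eq_mul]
    refine (Finset.card_nsmul_le_sum _ _ _ fun x hx => ?_).trans
      (Finset.sum_le_sum_of_subset_of_nonneg (Finset.filter_subset _ _)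
        fun x _ _ => by positivity)
    simp only [Finset.mem_filter, Finset.mem_univ, true_and] at hx
    have hx' : 2 * (m : ℤ) * #(colourNbhd c A g x) < #A := by exact_mod_cast hx
    have h0 : (0 : ℤ) ≤ (m : ℤ) * #(colourNbhd c A g x) := by positivity
    nlinarith
  rw [← Finset.mul_sum] at h2
  have h3 : (#{x : F | 2 * m * #(colourNbhd c A g x) < #A} : ℤ) * #A * #A ≤
      4 * (m : ℤ) ^ 2 * q * #A := by nlinarith
  exact_mod_cast le_of_mul_le_mul_right h3 (by exact_mod_cast hA)

end Cyclotomy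

/-- In large fields, every complete edge-coloured graph embeds in the cyclotomic colouring. -/
theorem exists_colour_pattern (m n M : ℕ) :
    ∃ Q : ℕ, ∀ (F G : Type) [Field F] [Fintype F] [CommGroup G] [Fintype G] (c : F → G) (e : ℕ),
      Fintype.card G = m → (∀ x y, x ≠ 0 → y ≠ 0 → c (x * y) = c x * c y) →
      #{x : F | x ≠ 0 ∧ c x = 1} ≤ e → Fintype.card F = m * e + 1 → Q ≤ Fintype.card F →
      ∀ (A : Fin n → Finset F), (∀ i, Fintype.card F ≤ M * #(A i)) →
      ∀ col : Fin n → Fin n → G, ∃ a : Fin n → F, (∀ i, a i ∈ A i) ∧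
        ∀ i j, i < j → a j ≠ a i ∧ c (a j - a i) = col i j := by
  induction n generalizing M with
  | zero =>
    exact ⟨0, fun F G _ _ _ _ c e _ _ _ _ _ A _ col =>
      ⟨fun i => i.elim0, fun i => i.elim0, fun i => i.elim0⟩⟩
  | succ n ih =>
    obtain ⟨Q, hQ⟩ := ih (2 * m * M)
    refine ⟨max Q (M * (n * (4 * m ^ 2 * M)) + 1), ?_⟩
    intro F G _ _ _ _ c e hG hc he hF hq A hA col
    have hbad : ∀ j : Fin n,
        #{x : F | 2 * m * #(colourNbhd c (A j.succ) (col 0 j.succ) x) < #(A j.succ)} ≤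
          4 * m ^ 2 * M := by
      intro j
      have h1 := card_small_colourNbhd_mul_le hc he (by rw [hG]; exact hF) (A j.succ) (col 0 j.succ)
      rw [hG] at h1
      have h2 : 0 < #(A j.succ) := by
        by_contra h
        have := hA j.succ
        rw [Nat.eq_zero_of_not_pos h] at this
        have := Fintype.card_pos (α := F)
        omega
      refine Nat.le_of_mul_le_mul_right (h1.trans ?_) h2
      calc 4 * m ^ 2 * Fintype.card F ≤ 4 * m ^ 2 * (M * #(A j.succ)) :=
            Nat.mul_le_mul_left _ (hA _)
        _ = _ := by ring
    obtain ⟨a₀, ha₀, hgood⟩ : ∃ a₀ ∈ A 0, ∀ j : Fin n,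
        #(A j.succ) ≤ 2 * m * #(colourNbhd c (A j.succ) (col 0 j.succ) a₀) := by
      by_contra! hcon
      have hsub : A 0 ⊆ univ.biUnion fun j : Fin n =>
          ({x : F | 2 * m * #(colourNbhd c (A j.succ) (col 0 j.succ) x) < #(A j.succ)} :
            Finset F) := by
        intro x hx
        obtain ⟨j, hj⟩ := hcon x hx
        simp only [Finset.mem_biUnion, Finset.mem_univ, true_and, Finset.mem_filter]
        exact ⟨j, hj⟩
      have h1 := (Finset.card_le_card hsub).trans
        (Finset.card_biUnion_le_card_mul _ _ _ fun j _ => hbad j)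
      rw [Finset.card_univ, Fintype.card_fin] at h1
      have h2 := (hA 0).trans (Nat.mul_le_mul_left M h1)
      have h3 := (le_max_right Q _).trans hq
      omega
    obtain ⟨a, ha, hcol⟩ := hQ F G c e hG hc he hF ((le_max_left _ _).trans hq)
      (fun j => colourNbhd c (A j.succ) (col 0 j.succ) a₀)
      (fun j => by
        calc Fintype.card F ≤ M * #(A j.succ) := hA _
          _ ≤ M * (2 * m * #(colourNbhd c (A j.succ) (col 0 j.succ) a₀)) :=
            Nat.mul_le_mul_left _ (hgood j)
          _ = _ := by ring)
      (fun i j => col i.succ j.succ)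
    simp only [colourNbhd, Finset.mem_filter] at ha
    refine ⟨Fin.cons a₀ a, Fin.cases ha₀ fun j => (ha j).1, ?_⟩
    intro i j hij
    induction j using Fin.cases with
    | zero => exact absurd hij (Fin.not_lt_zero i)
    | succ j =>
      induction i using Fin.cases with
      | zero => simpa using (ha j).2
      | succ i => simpa using hcol i j (Fin.succ_lt_succ_iff.1 hij)

theorem exists_even_colouring {F : Type} [Field F] [Fintype F] {m e : ℕ} (he : e ≠ 0)
    (heven : Even e) (hF : Fintype.card F = m * e + 1) :
    ∃ (G : Type) (_ : CommGroup G) (_ : Fintype G) (c : F → G), Fintype.card G = m ∧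
      (∀ x y, x ≠ 0 → y ≠ 0 → c (x * y) = c x * c y) ∧ #{x : F | x ≠ 0 ∧ c x = 1} ≤ e ∧
      ∀ x, c (-x) = c x := by
  let G := (powMonoidHom e : Fˣ →* Fˣ).range
  let c : F → G := fun x => if h : x = 0 then 1 else ⟨Units.mk0 x h ^ e, Units.mk0 x h, rfl⟩
  have hFG : Nat.card Fˣ = m * e := by
    rw [Nat.card_eq_fintype_card, Fintype.card_units, hF, Nat.add_sub_cancel]
  refine ⟨G, inferInstance, inferInstance, c, ?_, ?_, ?_, ?_⟩
  · rw [← Nat.card_eq_fintype_card, IsCyclic.card_powMonoidHom_range, hFG,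
      Nat.gcd_eq_right (Dvd.intro_left m rfl), Nat.mul_div_cancel _ (Nat.pos_of_ne_zero he)]
  · intro x y hx hy
    simp only [c, hx, hy, mul_ne_zero hx hy, dif_neg, not_false_eq_true, Units.mk0_mul, mul_pow]
    rfl
  · refine le_trans ?_ (IsCyclic.card_pow_eq_one_le (α := Fˣ) (Nat.pos_of_ne_zero he))
    refine Finset.card_le_card_of_surjOn (fun x : Fˣ => (x : F)) fun x hx => ?_
    simp only [coe_filter, Finset.mem_univ, true_and, Set.mem_ofPred_eq] at hx
    refine ⟨Units.mk0 x hx.1, ?_, rfl⟩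
    have := hx.2
    simp only [c, hx.1, dif_neg, not_false_eq_true] at this
    simpa using congrArg Subtype.val this
  · intro x
    by_cases hx : x = 0
    · rw [hx, neg_zero]
    · have hx' : -x ≠ 0 := neg_ne_zero.2 hx
      simp only [c, hx, hx', dif_neg, not_false_eq_true]
      refine Subtype.ext (Units.ext ?_)
      simpa using heven.neg_pow x

/-- A base block whose differences realise each cyclotomic colour once develops into a design. -/
theorem hasGDD_of_colour_pattern {F G : Type} [Field F] [Fintype F] [CommGroup G] {c : F → G}
    {u : ℕ} (hF : ringChar F ≠ 2) (hc : ∀ x y, x ≠ 0 → y ≠ 0 → c (x * y) = c x * c y)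
    (hneg : ∀ x, c (-x) = c x) (a : Fin u → F) (ha : ∀ i j, i < j → a j ≠ a i)
    (hcol : ∀ g, ∃! p : Fin u × Fin u, p.1 < p.2 ∧ c (a p.2 - a p.1) = g) :
    HasGDD {u} (id : F → F) := by
  have ha' : Function.Injective a := by
    intro i j hij
    rcases lt_trichotomy i j with h | h | h
    · exact absurd hij.symm (ha i j h)
    · exact h
    · exact absurd hij (ha j i h)
  obtain ⟨half, hhalf⟩ : ∃ half : F → Prop, ∀ x, x ≠ 0 → (half (-x) ↔ ¬ half x) := by
    refine ⟨fun x => Fintype.equivFin F x < Fintype.equivFin F (-x), fun x hx => ?_⟩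
    have h1 : -x ≠ x := fun h => hx ((Ring.eq_self_iff_eq_zero_of_char_ne_two hF).1 h)
    have h2 := (Fintype.equivFin F).injective.ne h1
    simp only [neg_neg, not_lt]
    exact ⟨le_of_lt, fun h => lt_of_le_of_ne h h2⟩
  have hone : ∀ {κ δ : F}, κ ≠ 0 → δ ≠ 0 → (c κ = 1 ↔ c (κ * δ) = c δ) := by
    intro κ δ hκ hδ
    rw [hc _ _ hκ hδ, mul_eq_right]
  refine ⟨{κ : F // κ ≠ 0 ∧ c κ = 1 ∧ half κ} × F,
    fun i => univ.image fun j => i.1.1 * a j + i.2, fun i => ?_, fun i => Set.injOn_id _, ?_⟩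
  · rw [Set.mem_singleton_iff, Finset.card_image_of_injective, Finset.card_univ, Fintype.card_fin]
    intro j j' h
    exact ha' (mul_left_cancel₀ i.1.2.1 (add_right_cancel h))
  · intro x y hxy
    have hxy' : x - y ≠ 0 := sub_ne_zero.2 hxy
    obtain ⟨⟨i, j⟩, ⟨hij, hg⟩, hu⟩ := hcol (c (x - y))
    simp only at hij hg
    have hδ : a j - a i ≠ 0 := sub_ne_zero.2 (ha i j hij)
    obtain ⟨κ, hκ⟩ : ∃ κ, κ * (a j - a i) = x - y := ⟨_, div_mul_cancel₀ _ hδ⟩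
    have hκ0 : κ ≠ 0 := by
      rintro rfl
      exact hxy' (by rw [← hκ, zero_mul])
    have hκ1 : c κ = 1 := by rw [hone hκ0 hδ, hκ, hg]
    have huniq : ∀ i' j' κ' z', κ' ≠ 0 → c κ' = 1 → κ' * a i' + z' = x → κ' * a j' + z' = y →
        (κ' = κ ∧ z' = x - κ * a j) ∨ (κ' = -κ ∧ z' = x + κ * a i) := by
      intro i' j' κ' z' h0 h1 hx hy
      have hsub : κ' * (a i' - a j') = x - y := by rw [← hx, ← hy]; ring
      have hne : a i' - a j' ≠ 0 := by
        intro h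
        rw [h, mul_zero] at hsub
        exact hxy' hsub.symm
      have hcc := (hone h0 hne).1 h1
      rw [hsub] at hcc
      rcases lt_trichotomy i' j' with h | h | h
      · obtain ⟨rfl, rfl⟩ := Prod.mk.inj (hu (i', j') ⟨h, by rw [hcc, ← hneg, neg_sub]⟩)
        have : κ' = -κ := mul_right_cancel₀ hδ (by linear_combination -hsub + hκ)
        subst this
        exact Or.inr ⟨rfl, by linear_combination hx⟩
      · exact absurd (by rw [h, sub_self]) hne
      · obtain ⟨rfl, rfl⟩ := Prod.mk.inj (hu (j', i') ⟨h, hcc.symm⟩)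
        have : κ' = κ := mul_right_cancel₀ hδ (by rw [hsub, hκ])
        subst this
        exact Or.inl ⟨rfl, by linear_combination hx⟩
    simp only [Finset.mem_image, Finset.mem_univ, true_and]
    by_cases hh : half κ
    · refine ⟨(⟨κ, hκ0, hκ1, hh⟩, x - κ * a j), ⟨⟨j, by ring⟩, ⟨i, by linear_combination -hκ⟩⟩, ?_⟩
      rintro ⟨⟨κ', h0, h1, h2⟩, z'⟩ ⟨⟨i', hi'⟩, ⟨j', hj'⟩⟩
      rcases huniq i' j' κ' z' h0 h1 hi' hj' with ⟨rfl, rfl⟩ | ⟨rfl, -⟩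
      · rfl
      · exact absurd hh ((hhalf κ hκ0).1 h2)
    · refine ⟨(⟨-κ, neg_ne_zero.2 hκ0, by rw [hneg, hκ1], (hhalf κ hκ0).2 hh⟩, x + κ * a i),
        ⟨⟨i, by ring⟩, ⟨j, by linear_combination -hκ⟩⟩, ?_⟩
      rintro ⟨⟨κ', h0, h1, h2⟩, z'⟩ ⟨⟨i', hi'⟩, ⟨j', hj'⟩⟩
      rcases huniq i' j' κ' z' h0 h1 hi' hj' with ⟨rfl, -⟩ | ⟨rfl, rfl⟩
      · exact absurd h2 hh
      · rfl

/-- Large finite fields of order `1` modulo `u * (u - 1)` carry designs with block size `u`. -/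
theorem exists_design_of_field (u : ℕ) :
    ∃ Q : ℕ, ∀ (F : Type) [Field F] [Fintype F], Q ≤ Fintype.card F →
      Fintype.card F ≡ 1 [MOD u * (u - 1)] → HasGDD {u} (id : F → F) := by
  obtain ⟨Q, hQ⟩ := exists_colour_pattern (Fintype.card {p : Fin u × Fin u // p.1 < p.2}) u 1
  refine ⟨Q, fun F _ _ hF hmod => ?_⟩
  have hm : Fintype.card {p : Fin u × Fin u // p.1 < p.2} * 2 = u * (u - 1) := by
    have h1 : Fintype.card {p : Fin u × Fin u // p.1 < p.2} =
        #{p : Fin u × Fin u | p.1 < p.2} := Fintype.card_subtype _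
    have h2 : #{p : Fin u × Fin u | p.2 < p.1} = #{p : Fin u × Fin u | p.1 < p.2} :=
      Finset.card_equiv (Equiv.prodComm _ _) (by simp)
    have h3 := Finset.offDiag_card (univ : Finset (Fin u))
    have h4 : (univ : Finset (Fin u)).offDiag =
        ({p : Fin u × Fin u | p.1 < p.2} : Finset _) ∪
          ({p : Fin u × Fin u | p.2 < p.1} : Finset _) := by
      ext p
      simp [lt_or_lt_iff_ne]
    rw [h4, Finset.card_union_of_disjoint, h2] at h3
    · rw [h1, mul_two, h3, Finset.card_univ, Fintype.card_fin, Nat.mul_sub_one]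
    · rw [Finset.disjoint_filter]
      exact fun p _ h h' => lt_asymm h h'
  have hcard : 1 < Fintype.card F := Fintype.one_lt_card
  obtain ⟨f, hf⟩ : u * (u - 1) ∣ Fintype.card F - 1 := (Nat.modEq_iff_dvd' hcard.le).1 hmod.symm
  have hF' : Fintype.card F =
      Fintype.card {p : Fin u × Fin u // p.1 < p.2} * (2 * f) + 1 := by
    rw [← mul_assoc, hm]
    omega
  have hf0 : f ≠ 0 := by
    rintro rfl
    omega
  obtain ⟨G, _, _, c, hG, hc, hker, hneg⟩ :=
    exists_even_colouring (mul_ne_zero two_ne_zero hf0) (even_two_mul f) hF'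
  let φ := Fintype.equivOfCardEq hG.symm
  obtain ⟨a, -, ha⟩ := hQ F G c _ hG hc hker hF' hF (fun _ => univ) (by simp)
    (fun i j => if h : i < j then φ ⟨(i, j), h⟩ else 1)
  refine hasGDD_of_colour_pattern ?_ hc hneg a (fun i j h => (ha i j h).1) fun g => ?_
  · rw [Ne, FiniteField.even_card_iff_char_two, hF', mul_left_comm]
    omega
  · refine ⟨(φ.symm g).1, ⟨(φ.symm g).2, ?_⟩, ?_⟩
    · rw [(ha _ _ (φ.symm g).2).2, dif_pos (φ.symm g).2]
      exact φ.apply_symm_apply g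
    · rintro ⟨i, j⟩ ⟨hij, hg⟩
      rw [(ha i j hij).2, dif_pos hij] at hg
      rw [← hg, Equiv.symm_apply_apply]

theorem exists_design_of_isPrimePow (u : ℕ) :
    ∃ Q : ℕ, ∀ q, IsPrimePow q → Q ≤ q → q ≡ 1 [MOD u * (u - 1)] →
      HasGDD {u} (id : Fin q → Fin q) := by
  obtain ⟨Q, hQ⟩ := exists_design_of_field u
  refine ⟨Q, fun q hq hle hmod => ?_⟩
  rw [isPrimePow_nat_iff] at hq
  obtain ⟨p, d, hp, hd, rfl⟩ := hq
  have : Fact p.Prime := ⟨hp⟩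
  have : Fintype (GaloisField p d) := Fintype.ofFinite _
  have hc : Fintype.card (GaloisField p d) = p ^ d := by
    rw [← Nat.card_eq_fintype_card, GaloisField.card p d hd.ne']
  exact (hQ (GaloisField p d) (by rwa [hc]) (by rwa [hc])).of_equiv
    (Fintype.equivFinOfCardEq hc).symm (by simp)

/-- Deleting a point of a design; the blocks through it become the groups. -/
theorem HasGDD.delete_point {k r : ℕ} {W : Type} [Fintype W] (hk : 2 ≤ k)
    (hW : Fintype.card W = (k - 1) * r) (h : HasGDD {k} (id : Option W → Option W)) :
    BlowUp k r (k - 1) := by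
  obtain ⟨ι, B, h1, -, h3⟩ := h
  simp only [Set.mem_singleton_iff] at h1
  have hex : ∀ w : W, ∃! i, none ∈ B i ∧ some w ∈ B i := fun w => h3 _ _ (by simp)
  choose g hg hgu using hex
  let g' : W → {i // none ∈ B i} := fun w => ⟨g w, (hg w).1⟩
  have hfib : ∀ i w, g' w = i ↔ some w ∈ B i := by
    intro i w
    constructor
    · rintro rfl
      exact (hg w).2
    · intro hw
      exact Subtype.ext (hgu w i ⟨i.2, hw⟩).symm
  have hcard : ∀ i, Fintype.card {w // g' w = i} = k - 1 := by
    intro i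
    rw [Fintype.card_subtype, ← h1 i.1, ← Finset.card_erase_of_mem i.2,
      ← Finset.card_map Function.Embedding.some]
    congr 1
    ext (_ | w) <;> simp [hfib]
  have hsurj : Function.Surjective g' := by
    intro i
    have : 0 < Fintype.card {w // g' w = i} := by
      rw [hcard]
      omega
    obtain ⟨w, hw⟩ := Fintype.card_pos_iff.1 this
    exact ⟨w, hw⟩
  have : Finite {i // none ∈ B i} := Finite.of_surjective g' hsurj
  have : Fintype {i // none ∈ B i} := Fintype.ofFinite _
  refine (BlowUp.iff_of_card (g := g') ?_ fun i => by convert hcard i).2 ?_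
  · have := Fintype.card_congr (Equiv.sigmaFiberEquiv g')
    rw [Fintype.card_sigma, Finset.sum_congr rfl fun i _ => hcard i, Finset.sum_const, smul_eq_mul,
      Finset.card_univ, hW, mul_comm] at this
    exact Nat.eq_of_mul_eq_mul_left (by omega) this
  · refine ⟨{i // none ∉ B i}, fun i => (B i).preimage some (Option.some_injective W).injOn,
      fun i => ?_, fun i x hx y hy hxy => ?_, fun x y hxy => ?_⟩
    · rw [Set.mem_singleton_iff, ← h1 i, ← Finset.card_map Function.Embedding.some]
      congr 1
      ext (_ | w) <;> simp [i.2]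
    · by_contra hne
      simp only [coe_preimage, Set.mem_preimage, SetLike.mem_coe] at hx hy
      refine i.2 ?_
      rw [(h3 (some x) (some y) (by simpa using hne)).unique ⟨hx, hy⟩
        ⟨(hg x).2, (hfib (g' x) y).1 hxy.symm⟩]
      exact (hg x).1
    · have hne : x ≠ y := fun h => hxy (congrArg g' h)
      obtain ⟨i, hi, hu⟩ := h3 (some x) (some y) (by simpa using hne)
      have hi0 : none ∉ B i := fun h0 => hxy
        (((hfib ⟨i, h0⟩ x).2 hi.1).trans ((hfib ⟨i, h0⟩ y).2 hi.2).symm)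
      refine ⟨⟨i, hi0⟩, by simpa using hi, fun j hj => Subtype.ext (hu j (by simpa using hj))⟩

/-- Adjoining a point to all groups of a design. -/
theorem BlowUp.add_point {k r : ℕ} (hk : 1 ≤ k) (h : BlowUp k r (k - 1)) :
    HasGDD {k} (id : Option (Fin r × Fin (k - 1)) → _) := by
  obtain ⟨ι, B, h1, h2, h3⟩ := h
  simp only [Set.mem_singleton_iff] at h1
  let G : Fin r → Finset (Option (Fin r × Fin (k - 1))) := fun j =>
    insertNone (({j} : Finset (Fin r)) ×ˢ univ)
  have hG : ∀ x j, some x ∈ G j ↔ x.1 = j := by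
    intro x j
    simp only [G, some_mem_insertNone, Finset.mem_product, Finset.mem_singleton, Finset.mem_univ,
      and_true]
  have hG' : ∀ j, none ∈ G j := fun j => by simp [G]
  refine ⟨ι ⊕ Fin r, Sum.elim (fun i => (B i).map Function.Embedding.some) G, ?_,
    fun _ => Set.injOn_id _, ?_⟩
  · rintro (i | j)
    · simpa using h1 i
    · simp only [Sum.elim_inr, G, Finset.card_insertNone, Finset.card_product,
        Finset.card_singleton, Finset.card_univ, Fintype.card_fin, one_mul, Set.mem_singleton_iff]
      omega
  · have key : ∀ (x : Fin r × Fin (k - 1)) (y : Option (Fin r × Fin (k - 1))), some x ≠ y →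
        ∃! i : ι ⊕ Fin r, some x ∈ Sum.elim (fun i => (B i).map Function.Embedding.some) G i ∧
          y ∈ Sum.elim (fun i => (B i).map Function.Embedding.some) G i := by
      rintro x (_ | y) hxy
      · refine ⟨Sum.inr x.1, ⟨(hG _ _).2 rfl, hG' _⟩, ?_⟩
        rintro (i | j) ⟨ha, hb⟩
        · simp at hb
        · rw [(hG _ _).1 ha]
      · by_cases hg : x.1 = y.1
        · refine ⟨Sum.inr x.1, ⟨(hG _ _).2 rfl, (hG _ _).2 hg.symm⟩, ?_⟩
          rintro (i | j) ⟨ha, hb⟩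
          · simp only [Sum.elim_inl, Finset.mem_map, Function.Embedding.some_apply,
              Option.some.injEq, exists_eq_right] at ha hb
            exact absurd (congrArg some (h2 i ha hb hg)) hxy
          · rw [(hG _ _).1 ha]
        · obtain ⟨i, hi, hu⟩ := h3 x y hg
          refine ⟨Sum.inl i, by simpa using hi, ?_⟩
          rintro (i' | j) ⟨ha, hb⟩
          · simp only [Sum.elim_inl, Finset.mem_map, Function.Embedding.some_apply,
              Option.some.injEq, exists_eq_right] at ha hb
            rw [hu i' ⟨ha, hb⟩]
          · exact absurd (((hG _ _).1 ha).trans ((hG _ _).1 hb).symm) hg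
    rintro (_ | x) y hxy
    · rcases y with _ | y
      · exact absurd rfl hxy
      · simpa [and_comm] using key y none (by simp)
    · exact key x y hxy

/-- Designs on `(k - 1) * r + 1` points are the same as uniform designs with `r` groups of size
`k - 1`. -/
theorem BlowUp.iff_design {k r : ℕ} (hk : 2 ≤ k) :
    BlowUp k r (k - 1) ↔ HasGDD {k} (id : Fin ((k - 1) * r + 1) → _) := by
  constructor
  · intro h
    exact (h.add_point (by omega)).of_equiv
      (Fintype.equivOfCardEq (by simp [mul_comm])) (by simp)
  · intro h
    refine HasGDD.delete_point (W := Fin ((k - 1) * r)) hk (Fintype.card_fin _) (h.of_equiv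
      (Fintype.equivOfCardEq (by simp)) (by simp))

theorem BlowUp.iff_design_one {k n : ℕ} : BlowUp k n 1 ↔ HasGDD {k} (id : Fin n → Fin n) :=
  BlowUp.iff_of_card (Fintype.card_fin n) fun i => by
    simp

section

variable {k : ℕ}

theorem exists_blowUp_of_isPrimePow (hk : 2 ≤ k) :
    ∃ Q : ℕ, ∀ r, k ∣ r → IsPrimePow ((k - 1) * r + 1) → Q ≤ r →
      BlowUp k r (k - 1) ∧ BlowUp k (k * r + 1) (k - 1) := by
  obtain ⟨Q, hQ⟩ := exists_design_of_isPrimePow k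
  refine ⟨Q + k, fun r hr hpp hle => ?_⟩
  have hr1 : r ≤ (k - 1) * r := Nat.le_mul_of_pos_left r (by omega)
  have hB : HasGDD {k} (id : Fin ((k - 1) * r + 1) → _) := by
    refine hQ _ hpp (by omega) ?_
    obtain ⟨s, rfl⟩ := hr
    have : (k - 1) * (k * s) + 1 = 1 + k * (k - 1) * s := by ring
    rw [this]
    exact Nat.modEq_iff_dvd.2 (by simp)
  refine ⟨(BlowUp.iff_design hk).2 hB, (BlowUp.iff_design hk).2 (BlowUp.iff_design_one.1 ?_)⟩
  have h1 := BlowUp.iff_design_one.2 hB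
  rw [isPrimePow_nat_iff] at hpp
  obtain ⟨p, d, hp, hd, hpd⟩ := hpp
  have h2 : BlowUp k k ((k - 1) * r + 1) := by
    rw [← hpd]
    exact BlowUp.of_prime_pow hp hd.ne' (by omega)
  have h3 := BlowUp.fill (c := 1) (by rwa [mul_one]) h1
  have h4 : (k - 1) * (k * r + 1) + 1 = k * ((k - 1) * r + 1) := by
    obtain ⟨j, rfl⟩ : ∃ j, k = j + 1 := ⟨k - 1, by omega⟩
    rw [Nat.add_sub_cancel]
    ring
  rwa [h4]

theorem exists_blowUp_of_prime (u : ℕ) :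
    ∃ Q : ℕ, ∀ q, q.Prime → Q ≤ q → q ≡ 1 [MOD u * (u - 1)] → ∀ w t, BlowUp w u t →
      BlowUp w q t := by
  obtain ⟨Q, hQ⟩ := exists_design_of_isPrimePow u
  refine ⟨Q, fun q hq hle hmod w t h => ?_⟩
  have := BlowUp.of_pbd (w := w) (t := t) (K := {u}) (by rintro κ rfl; exact h)
    (hQ q hq.isPrimePow hle hmod)
  rwa [Fintype.card_fin] at this

end

section FieldLemmas

variable {K L : Type} [Field K] [Field L] [Algebra K L]

open Polynomial in
theorem exists_linearIndependent_inv_sub [Fintype K] [Fintype L] {n : ℕ} {t : Fin n → L}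
    (ht : Function.Injective t) (hL : n + Fintype.card K ^ n * n < Fintype.card L) :
    ∃ T, (∀ x, t x ≠ T) ∧ LinearIndependent K fun x => (t x - T)⁻¹ := by
  let P : (Fin n → K) → L[X] := fun g =>
    ∑ x, C (algebraMap K L (g x)) * ∏ x' ∈ univ.erase x, (C (t x') - X)
  have hP : ∀ g T, (P g).eval T = ∑ x, algebraMap K L (g x) * ∏ x' ∈ univ.erase x, (t x' - T) := by
    intro g T
    simp [P, eval_finsetSum, eval_prod]
  have hP0 : ∀ g, g ≠ 0 → P g ≠ 0 := by
    intro g hg h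
    obtain ⟨x, hx⟩ := Function.ne_iff.1 hg
    have h1 := hP g (t x)
    rw [h, eval_zero, Finset.sum_eq_single x] at h1
    · rcases mul_eq_zero.1 h1.symm with h2 | h2
      · exact hx ((map_eq_zero _).1 h2)
      · obtain ⟨y, hy, hy'⟩ := Finset.prod_eq_zero_iff.1 h2
        exact (Finset.ne_of_mem_erase hy) (ht (sub_eq_zero.1 hy'))
    · intro y _ hy
      rw [Finset.prod_eq_zero (i := x), mul_zero]
      · exact Finset.mem_erase.2 ⟨hy.symm, Finset.mem_univ x⟩
      · exact sub_self _
    · simp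
  have hdeg : ∀ g, (P g).natDegree ≤ n := by
    intro g
    refine natDegree_sum_le_of_forall_le _ _ fun x _ => ?_
    refine (natDegree_C_mul_le _ _).trans ((natDegree_prod_le _ _).trans ?_)
    refine (Finset.sum_le_card_nsmul _ _ 1 fun y _ => ?_).trans ?_
    · exact (natDegree_sub_le _ _).trans (by simp)
    · simp
  obtain ⟨T, hT⟩ : ∃ T, T ∉ univ.image t ∪ univ.biUnion fun g => (P g).roots.toFinset := by
    by_contra! hcon
    refine absurd hL (not_lt.2 ?_)
    rw [← Finset.card_univ (α := L)]
    refine (Finset.card_le_card fun x _ => hcon x).trans ((Finset.card_union_le _ _).trans ?_)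
    refine Nat.add_le_add (Finset.card_image_le.trans (by simp)) ?_
    refine (Finset.card_biUnion_le_card_mul _ _ n fun g _ => ?_).trans (by simp)
    exact (Multiset.toFinset_card_le _).trans ((card_roots' _).trans (hdeg g))
  simp only [Finset.mem_union, Finset.mem_image, Finset.mem_univ, true_and, Finset.mem_biUnion,
    Multiset.mem_toFinset, not_or, not_exists] at hT
  refine ⟨T, hT.1, Fintype.linearIndependent_iff.2 fun g hg => ?_⟩
  by_contra! hne
  have hg0 : g ≠ 0 := fun h => by simp [h] at hne
  refine hT.2 g ((mem_roots (hP0 g hg0)).2 ?_)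
  rw [IsRoot, hP]
  have : ∀ x, t x - T ≠ 0 := fun x => sub_ne_zero.2 (hT.1 x)
  have h2 := congrArg (· * ∏ x, (t x - T)) hg
  simp only [zero_mul, Finset.sum_mul] at h2
  rw [← h2]
  refine Finset.sum_congr rfl fun x _ => ?_
  rw [← Finset.mul_prod_erase univ _ (Finset.mem_univ x), Algebra.smul_def]
  field_simp [this x]

theorem exists_functional_mul_eq [FiniteDimensional K L] {φ : L →ₗ[K] K} (hφ : φ ≠ 0) {ι : Type}
    {v : ι → L} (hv : LinearIndependent K v) (c : ι → K) : ∃ b, ∀ i, φ (b * v i) = c i := by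
  let Φ : L →ₗ[K] Module.Dual K L := (LinearMap.mul K L).compr₂ φ
  have hΦ : Function.Injective Φ := by
    rw [← LinearMap.ker_eq_bot, LinearMap.ker_eq_bot']
    intro b hb
    by_contra h0
    refine hφ (LinearMap.ext fun x => ?_)
    have := LinearMap.congr_fun hb (b⁻¹ * x)
    simpa [Φ, mul_inv_cancel_left₀ h0] using this
  have hsurj : Function.Surjective Φ :=
    (LinearMap.injective_iff_surjective_of_finrank_eq_finrank
      (Subspace.dual_finrank_eq).symm).1 hΦ
  obtain ⟨f, hf⟩ := LinearMap.exists_extend ((Module.Basis.span hv).constr K c)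
  obtain ⟨b, hb⟩ := hsurj f
  refine ⟨b, fun i => ?_⟩
  have h1 : f (v i) = c i := by
    have := LinearMap.congr_fun hf ((Module.Basis.span hv) i)
    rw [Module.Basis.constr_basis] at this
    rw [← this]
    simp [Module.Basis.span_apply]
  rw [← h1, ← hb]
  rfl

/-- The line slopes `t` can be chosen so that arbitrary prescribed residues of the difference
quotients are realised. -/
theorem exists_slopes_fin [Fintype K] [Fintype L] {φ : L →ₗ[K] K} (hφ : φ ≠ 0) (n : ℕ)
    (hL : n + Fintype.card K ^ n * n < Fintype.card L) :
    ∃ t : Fin n → L, Function.Injective t ∧ ∀ c : Fin n → Fin n → K, ∃ b : Fin n → L,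
      ∀ x y, x < y → φ ((b x - b y) / (t x - t y)) = c x y := by
  induction n with
  | zero => exact ⟨fun i => i.elim0, fun i => i.elim0,
      fun _ => ⟨fun i => i.elim0, fun i => i.elim0⟩⟩
  | succ n ih =>
    have hL' : n + Fintype.card K ^ n * n < Fintype.card L := by
      refine lt_of_le_of_lt ?_ hL
      gcongr <;> first | omega | exact Fintype.card_pos
    obtain ⟨t, ht, hb⟩ := ih hL'
    obtain ⟨T, hT, hlin⟩ := exists_linearIndependent_inv_sub (K := K) ht hL'
    refine ⟨Fin.snoc t T, ?_, fun c => ?_⟩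
    · rw [Fin.snoc_injective_iff]
      exact ⟨ht, by simpa using hT⟩
    · obtain ⟨b, hb⟩ := hb fun x y => c x.castSucc y.castSucc
      obtain ⟨β, hβ⟩ := exists_functional_mul_eq hφ hlin fun x =>
        φ (b x / (t x - T)) - c x.castSucc (Fin.last n)
      refine ⟨Fin.snoc b β, fun x y hxy => ?_⟩
      induction x using Fin.lastCases with
      | last => exact absurd hxy (not_lt.2 (Fin.le_last y))
      | cast x =>
        induction y using Fin.lastCases with
        | last =>
          have := hβ x
          simp only [Fin.snoc_castSucc, Fin.snoc_last]
          rw [sub_div, map_sub, div_eq_mul_inv β, this, sub_sub_cancel]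
        | cast y => simpa using hb x y (by simpa using hxy)

theorem exists_slopes [Fintype K] [Fintype L] {φ : L →ₗ[K] K} (hφ : φ ≠ 0) (V : Type) [Fintype V]
    (hL : Fintype.card V + Fintype.card K ^ Fintype.card V * Fintype.card V < Fintype.card L) :
    ∃ t : V → L, Function.Injective t ∧ ∀ c : V → V → K, (∀ x y, c x y = c y x) → ∃ b : V → L,
      ∀ x y, x ≠ y → φ ((b x - b y) / (t x - t y)) = c x y := by
  obtain ⟨t, ht, h⟩ := exists_slopes_fin hφ _ hL
  let e := Fintype.equivFin V
  refine ⟨t ∘ e, ht.comp e.injective, fun c hc => ?_⟩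
  obtain ⟨b, hb⟩ := h fun x y => c (e.symm x) (e.symm y)
  refine ⟨b ∘ e, fun x y hxy => ?_⟩
  rcases lt_or_gt_of_ne (e.injective.ne hxy) with hlt | hlt
  · simpa using hb _ _ hlt
  · have := hb _ _ hlt
    rw [← neg_sub, ← neg_sub (t (e x)), neg_div_neg_eq] at this
    simpa [hc x y] using this

end FieldLemmas

/-- The analogue of `HasGDD` with all blocks of size `w` in which points of different groups lie in
exactly `lam` common blocks. -/
def HasMultiGDD (w lam : ℕ) {V I : Type} (g : V → I) : Prop :=
  ∃ (ι : Type) (_ : Fintype ι) (B : ι → Finset V), (∀ i, #(B i) = w) ∧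
    (∀ i, Set.InjOn g (B i)) ∧ ∀ x y, g x ≠ g y → #{i | x ∈ B i ∧ y ∈ B i} = lam

namespace HasMultiGDD

variable {w : ℕ} {V I : Type} {g : V → I}

theorem hasGDD (h : HasMultiGDD w 1 g) : HasGDD {w} g := by
  obtain ⟨ι, _, B, h1, h2, h3⟩ := h
  refine ⟨ι, B, h1, h2, fun x y hxy => ?_⟩
  obtain ⟨i, hi⟩ := Finset.card_eq_one.1 (h3 x y hxy)
  simp only [Finset.ext_iff, Finset.mem_filter, Finset.mem_univ, true_and,
    Finset.mem_singleton] at hi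
  exact ⟨i, (hi i).2 rfl, fun j hj => (hi j).1 hj⟩

theorem complete {m : ℕ} (hw : 2 ≤ w) :
    HasMultiGDD w ((m - 2).choose (w - 2)) (id : Fin m → Fin m) := by
  refine ⟨{s : Finset (Fin m) // #s = w}, inferInstance, Subtype.val, Subtype.prop,
    fun _ => Set.injOn_id _, fun x y hxy => ?_⟩
  have hxy' : x ≠ y := hxy
  have h2 : #{x, y} = 2 := Finset.card_pair hxy'
  have h3 : #(univ \ {x, y} : Finset (Fin m)) = m - 2 := by
    rw [Finset.card_sdiff_of_subset (Finset.subset_univ _), Finset.card_univ, Fintype.card_fin, h2]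
  rw [← h3, ← Finset.card_powersetCard]
  have hdisj : ∀ s ∈ powersetCard (w - 2) (univ \ {x, y} : Finset (Fin m)),
      Disjoint s {x, y} := fun s hs =>
    Finset.disjoint_of_subset_left (Finset.mem_powersetCard.1 hs).1 Finset.sdiff_disjoint
  have hcard : ∀ s ∈ powersetCard (w - 2) (univ \ {x, y} : Finset (Fin m)),
      #(s ∪ {x, y}) = w := fun s hs => by
    rw [Finset.card_union_of_disjoint (hdisj s hs), h2, (Finset.mem_powersetCard.1 hs).2]
    omega
  refine Finset.card_bij' (fun s _ => s.1 \ {x, y}) (fun s hs => ⟨s ∪ {x, y}, hcard s hs⟩)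
    ?_ ?_ ?_ ?_
  · rintro ⟨s, hs⟩ hs'
    simp only [Finset.mem_filter, Finset.mem_univ, true_and] at hs'
    rw [Finset.mem_powersetCard]
    refine ⟨Finset.sdiff_subset_sdiff (Finset.subset_univ _) le_rfl, ?_⟩
    rw [Finset.card_sdiff_of_subset, h2, hs]
    rw [Finset.insert_subset_iff, Finset.singleton_subset_iff]
    exact hs'
  · intro s hs
    simp
  · rintro ⟨s, hs⟩ hs'
    simp only [Finset.mem_filter, Finset.mem_univ, true_and] at hs'
    refine Subtype.ext (Finset.sdiff_union_of_subset ?_)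
    rw [Finset.insert_subset_iff, Finset.singleton_subset_iff]
    exact hs'
  · intro s hs
    exact Finset.union_sdiff_cancel_right (hdisj s hs)

/-- Inflating by a large extension of a finite field `K` divides the multiplicity by `#K`. -/
theorem reduce {K L : Type} [Field K] [Fintype K] [Field L] [Fintype L] [Algebra K L] [Fintype V]
    {μ : ℕ} (h : HasMultiGDD w (Fintype.card K * μ) g)
    (hL : Fintype.card V + Fintype.card K ^ Fintype.card V * Fintype.card V < Fintype.card L) :
    HasMultiGDD w μ (fun x : V × L => g x.1) := by
  obtain ⟨ι, _, B, h1, h2, h3⟩ := h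
  obtain ⟨φ, hφ⟩ : ∃ φ : L →ₗ[K] K, φ ≠ 0 := exists_ne 0
  obtain ⟨t, ht, hb⟩ := exists_slopes hφ V hL
  have hcol : ∀ T : Finset ι, ∃ f : ι → K, #T = Fintype.card K * μ →
      ∀ c, #{i ∈ T | f i = c} = μ := by
    intro T
    by_cases hT : #T = Fintype.card K * μ
    · let e : T ≃ K × Fin μ := Fintype.equivOfCardEq (by simp [hT])
      refine ⟨fun i => if hi : i ∈ T then (e ⟨i, hi⟩).1 else 0, fun _ c => ?_⟩
      have hinj : Function.Injective fun j : Fin μ => (e.symm (c, j)).1 := fun j j' hjj => by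
        simpa using Subtype.val_injective hjj
      have : ({i ∈ T | (if hi : i ∈ T then (e ⟨i, hi⟩).1 else 0) = c} : Finset ι) =
          univ.image fun j : Fin μ => (e.symm (c, j)).1 := by
        ext i
        simp only [Finset.mem_filter, Finset.mem_image, Finset.mem_univ, true_and]
        constructor
        · rintro ⟨hi, hc⟩
          rw [dif_pos hi] at hc
          exact ⟨(e ⟨i, hi⟩).2, by rw [← hc]; simp⟩
        · rintro ⟨j, rfl⟩
          simp
      rw [this, Finset.card_image_of_injective _ hinj, Finset.card_univ, Fintype.card_fin]
    · exact ⟨0, fun h => absurd h hT⟩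
  choose f hf using hcol
  let T : V → V → Finset ι := fun x y => {i | x ∈ B i ∧ y ∈ B i}
  have hT : ∀ x y, T x y = T y x := fun x y => by simp only [T, and_comm]
  choose b hb using fun i => hb (fun x y => f (T x y) i) fun x y => by rw [hT]
  let W := LinearMap.ker φ
  let pt : ι → W → L → V → V × L := fun i s z x => (x, t x * s + b i x + z)
  have hpt : ∀ i s z x ξ, (x, ξ) ∈ (B i).image (pt i s z) ↔
      x ∈ B i ∧ t x * s + b i x + z = ξ := by
    intro i s z x ξ
    simp only [Finset.mem_image, pt, Prod.mk.injEq]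
    constructor
    · rintro ⟨x', hx', rfl, rfl⟩
      exact ⟨hx', rfl⟩
    · rintro ⟨hx, rfl⟩
      exact ⟨x, hx, rfl, rfl⟩
  refine ⟨ι × W × L, inferInstance, fun j => (B j.1).image (pt j.1 j.2.1 j.2.2), fun j => ?_,
    fun j x hx y hy hxy => ?_, ?_⟩
  · rw [Finset.card_image_of_injective _ fun x y hxy => congrArg Prod.fst hxy, h1]
  · obtain ⟨x, ξ⟩ := x
    obtain ⟨y, η⟩ := y
    rw [SetLike.mem_coe, hpt] at hx hy
    obtain rfl := h2 j.1 hx.1 hy.1 hxy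
    rw [← hx.2, ← hy.2]
  · rintro ⟨x, ξ⟩ ⟨y, η⟩ hxy
    have hne : x ≠ y := fun h => hxy (congrArg g h)
    have hsub : t x - t y ≠ 0 := sub_ne_zero.2 (ht.ne hne)
    rw [← hf (T x y) (h3 x y hxy) (φ ((ξ - η) / (t x - t y)))]
    refine Finset.card_nbij Prod.fst ?_ ?_ ?_
    · rintro ⟨i, s, z⟩ hj
      simp only [coe_filter, Finset.mem_univ, true_and, Set.mem_ofPred_eq, hpt] at hj
      obtain ⟨⟨hx, rfl⟩, ⟨hy, rfl⟩⟩ := hj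
      simp only [coe_filter, Set.mem_ofPred_eq]
      refine ⟨by simp [T, hx, hy], ?_⟩
      rw [← hb i x y hne]
      have : (t x * (s : L) + b i x + z - (t y * s + b i y + z)) / (t x - t y) =
          s + (b i x - b i y) / (t x - t y) := by
        field_simp
        ring
      rw [this, map_add, LinearMap.mem_ker.1 s.2, zero_add]
    · rintro ⟨i, s, z⟩ hj ⟨i', s', z'⟩ hj' hii
      obtain rfl : i = i' := hii
      simp only [coe_filter, Finset.mem_univ, true_and, Set.mem_ofPred_eq, hpt] at hj hj'
      have hs : (s : L) = s' := by
        refine mul_left_cancel₀ hsub ?_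
        linear_combination hj.1.2 - hj.2.2 - hj'.1.2 + hj'.2.2
      obtain rfl := Subtype.ext hs
      have hz : z = z' := by linear_combination hj.1.2 - hj'.1.2
      rw [hz]
    · rintro i hi
      simp only [coe_filter, Set.mem_ofPred_eq, T, Finset.mem_filter, Finset.mem_univ,
        true_and] at hi
      obtain ⟨⟨hx, hy⟩, hc⟩ := hi
      have hker : (ξ - η - (b i x - b i y)) / (t x - t y) ∈ LinearMap.ker φ := by
        rw [LinearMap.mem_ker, sub_div, map_sub, hb i x y hne, ← hc, sub_self]
      refine ⟨(i, ⟨_, hker⟩,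
        ξ - t x * ((ξ - η - (b i x - b i y)) / (t x - t y)) - b i x), ?_, rfl⟩
      simp only [coe_filter, Finset.mem_univ, true_and, Set.mem_ofPred_eq, hpt]
      refine ⟨⟨hx, by ring⟩, hy, ?_⟩
      field_simp
      ring

theorem exists_inflation [Fintype V] {lam : ℕ} (hlam : lam ≠ 0) (h : HasMultiGDD w lam g) :
    ∃ D, D ≠ 0 ∧ BlowUp w w D ∧ HasGDD {w} (fun x : V × Fin D => g x.1) := by
  induction lam using Nat.strong_induction_on generalizing V with
  | _ lam ih =>
    by_cases h1 : lam = 1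
    · subst h1
      exact ⟨1, one_ne_zero, BlowUp.self_one w,
        h.hasGDD.of_equiv (Equiv.prodUnique V (Fin 1)) fun x y => Iff.rfl⟩
    · obtain ⟨p, hp, μ, rfl⟩ := Nat.exists_prime_and_dvd h1
      have : Fact p.Prime := ⟨hp⟩
      have hμ : μ ≠ 0 := right_ne_zero_of_mul hlam
      have hlt : μ < p * μ := lt_mul_of_one_lt_left (Nat.pos_of_ne_zero hμ) hp.one_lt
      set N := w + (Fintype.card V + p ^ Fintype.card V * Fintype.card V) + 1
      have hN : N < p ^ N := Nat.lt_pow_self hp.one_lt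
      have : Fintype (GaloisField p N) := Fintype.ofFinite _
      have hL : Fintype.card (GaloisField p N) = p ^ N := by
        rw [← Nat.card_eq_fintype_card, GaloisField.card p N (Nat.succ_ne_zero _)]
      have hred := reduce (K := ZMod p) (L := GaloisField p N) (by rwa [ZMod.card])
        (by rw [ZMod.card, hL]; omega)
      obtain ⟨D, hD, hw, hV⟩ := ih μ hlt hμ hred
      refine ⟨p ^ N * D, mul_ne_zero (pow_ne_zero _ hp.ne_zero) hD,
        (BlowUp.of_prime_pow hp (Nat.succ_ne_zero _) (le_trans (by omega) hN.le)).mul hw, ?_⟩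
      refine hV.of_equiv (((Equiv.refl V).prodCongr (finProdFinEquiv.symm.trans
        ((Fintype.equivFinOfCardEq hL).symm.prodCongr (Equiv.refl (Fin D))))).trans
          (Equiv.prodAssoc _ _ _).symm) fun x y => Iff.rfl

end HasMultiGDD

theorem BlowUp.exists_of_le {w m : ℕ} (hw : 2 ≤ w) (hm : w ≤ m) :
    ∃ D, D ≠ 0 ∧ BlowUp w w D ∧ BlowUp w m D := by
  obtain ⟨D, hD, h1, h2⟩ := (HasMultiGDD.complete (w := w) (m := m) hw).exists_inflation
    (Nat.choose_pos (by omega)).ne'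
  exact ⟨D, hD, h1, h2⟩

theorem BlowUp.exists_of_mem_Icc {w : ℕ} (hw : 2 ≤ w) (b : ℕ) :
    ∃ D, D ≠ 0 ∧ BlowUp w w D ∧ ∀ m, w ≤ m → m ≤ b → BlowUp w m D := by
  induction b with
  | zero => exact ⟨1, one_ne_zero, self_one w, fun m h1 h2 => absurd (h1.trans h2) (by omega)⟩
  | succ b ih =>
    obtain ⟨D, hD, h1, h2⟩ := ih
    rcases lt_or_ge (b + 1) w with hb | hb
    · exact ⟨D, hD, h1, fun m h3 h4 => h2 m h3 (by omega)⟩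
    · obtain ⟨D', hD', h3, h4⟩ := exists_of_le hw hb
      refine ⟨D * D', mul_ne_zero hD hD', h1.mul h3, fun m h5 h6 => ?_⟩
      rcases Nat.lt_or_ge m (b + 1) with h7 | h7
      · exact (h2 m h5 (by omega)).mul h3
      · obtain rfl := le_antisymm h6 h7
        rw [mul_comm]
        exact h4.mul h1

/-- A single group size works for all sufficiently many groups. -/
theorem BlowUp.exists_forall_of_le {w : ℕ} (hw : 2 ≤ w) :
    ∃ D, D ≠ 0 ∧ ∀ m, w ≤ m → BlowUp w m D := by
  set M := (w + 1).factorial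
  have hM : 0 < M := Nat.factorial_pos _
  obtain ⟨D, hD, hww, hb⟩ := exists_of_mem_Icc hw (2 * w + w * M * (2 * w))
  refine ⟨D, hD, fun m hm => ?_⟩
  induction m using Nat.strong_induction_on with
  | _ m ih =>
    rcases le_or_gt m (2 * w + w * M * (2 * w)) with h | h
    · exact hb m hm h
    · have hwM : 0 < w * M := Nat.mul_pos (by omega) hM
      set j := (m - 2 * w) / (w * M)
      have hj1 : w * M * j ≤ m - 2 * w := Nat.mul_div_le _ _
      have hj2 : m - 2 * w < w * M * (j + 1) := Nat.lt_mul_div_succ _ hwM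
      have hj3 : 2 * w ≤ j := (Nat.le_div_iff_mul_le hwM).2 (by rw [mul_comm]; omega)
      have hMj : 2 * w * M ≤ M * j := by
        rw [mul_comm]
        exact Nat.mul_le_mul_left M hj3
      have hwM' : w ≤ w * M := Nat.le_mul_of_pos_right w hM
      set t := M * j + 1
      have ht : w * t = w * M * j + w := by simp only [t]; ring
      have hts : m - w * t ≤ t := by
        rw [mul_add, mul_one] at hj2
        rw [mul_assoc] at hMj
        omega
      have hMj' : M * j ≤ w * M * j := by
        rw [mul_assoc]
        exact Nat.le_mul_of_pos_left _ (by omega)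
      have hcop : t.Coprime (w + 1).factorial := by
        simp [t, M]
      have := truncate (u := w) (m := w) (E := t) (s := m - w * t) (w := w) (t := D)
        (of_coprime (Nat.succ_pos _) hcop) hts hww
        (hb (w + 1) (by omega) (by omega)) (ih t (by omega) (by nlinarith))
        (ih (m - w * t) (by omega) (by omega))
      rwa [Nat.add_sub_cancel' (by omega)] at this

theorem exists_prime_one_add_mul {X B : ℕ} (Q : ℕ) (hX : X ≠ 0) (hB : B ≠ 0)
    (h : (1 + X).Coprime B) : ∃ t, Q ≤ t ∧ t ≡ 1 [MOD B] ∧ (1 + X * t).Prime := by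
  obtain ⟨p, hp, hpp, hmod⟩ := Nat.forall_exists_prime_gt_and_modEq (1 + X * Q)
    (mul_ne_zero hX hB) (Nat.Coprime.mul_right (by simp) h)
  have h1 : X ∣ p - 1 := by
    refine (Nat.modEq_iff_dvd' (by omega)).1 ?_
    have := (hmod.of_mul_right B).symm
    rwa [Nat.ModEq, Nat.add_mod_right] at this
  obtain ⟨t, ht⟩ := h1
  obtain rfl : p = 1 + X * t := by omega
  refine ⟨t, ?_, ?_, hpp⟩
  · exact (Nat.lt_of_mul_lt_mul_left (Nat.lt_of_add_lt_add_left hp)).le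
  · refine Nat.ModEq.mul_left_cancel' hX ?_
    rw [mul_one]
    exact Nat.ModEq.add_left_cancel' 1 hmod

theorem exists_modEq_mem_Ico {P : ℕ} (hP : P ≠ 0) (c L : ℕ) :
    ∃ x, L ≤ x ∧ x < L + P ∧ x ≡ c [MOD P] := by
  refine ⟨L + (c + (P - 1) * L) % P, Nat.le_add_right _ _,
    Nat.add_lt_add_left (Nat.mod_lt _ (Nat.pos_of_ne_zero hP)) _, ?_⟩
  refine ((Nat.mod_modEq _ _).add_left L).trans ?_
  have : L + (c + (P - 1) * L) = c + P * L := by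
    obtain ⟨P, rfl⟩ := Nat.exists_eq_succ_of_ne_zero hP
    rw [Nat.succ_sub_one, Nat.succ_mul]
    omega
  rw [this]
  simp [Nat.ModEq]

/-- A set of residues modulo `E` closed under addition is cut out by local conditions. -/
theorem mem_of_forall_prime {S : Set ℕ} {E k : ℕ} (hE : E ≠ 0) (h0 : 0 ∈ S)
    (hadd : ∀ a ∈ S, ∀ b ∈ S, a + b ∈ S) (hmod : ∀ a b, a ≡ b [MOD E] → a ∈ S → b ∈ S)
    (hloc : ∀ p, p.Prime → p ∣ E → ∃ d ∈ S, ∀ i, p ^ i ∣ d → p ^ i ∣ k) : k ∈ S := by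
  have hmul : ∀ n, ∀ a ∈ S, n * a ∈ S := by
    intro n a ha
    induction n with
    | zero => rwa [zero_mul]
    | succ n ih => rw [Nat.succ_mul]; exact hadd _ ih _ ha
  have hES : E ∈ S := hmod 0 E (by simp [Nat.ModEq]) h0
  have hex : ∃ g, 0 < g ∧ g ∈ S := ⟨E, Nat.pos_of_ne_zero hE, hES⟩
  obtain ⟨hg0, hgS⟩ := Nat.find_spec hex
  set g := Nat.find hex
  have hdvd : ∀ d ∈ S, g ∣ d := by
    intro d hd
    have h1 : d + (d / g * (E - 1)) * g ∈ S := hadd _ hd _ (hmul _ _ hgS)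
    have h2 : d % g ∈ S := by
      refine hmod _ _ ?_ h1
      have : d + (d / g * (E - 1)) * g = d % g + E * (d / g * g) := by
        conv_lhs => rw [← Nat.mod_add_div d g]
        obtain ⟨E, rfl⟩ := Nat.exists_eq_succ_of_ne_zero hE
        rw [Nat.mod_add_div, Nat.succ_sub_one, Nat.succ_eq_add_one]
        linear_combination -(Nat.mod_add_div d g)
      rw [this]
      simp [Nat.ModEq]
    by_contra hnd
    have h3 := Nat.find_min hex (Nat.mod_lt d hg0)
    exact h3 ⟨Nat.pos_of_ne_zero fun h => hnd (Nat.dvd_of_mod_eq_zero h), h2⟩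
  have hgk : g ∣ k := by
    rw [Nat.dvd_iff_prime_pow_dvd_dvd]
    intro p i hp hi
    rcases Nat.eq_zero_or_pos i with rfl | hi0
    · rw [pow_zero]
      exact one_dvd _
    · obtain ⟨d, hd, h⟩ := hloc p hp
        (((dvd_pow_self p hi0.ne').trans hi).trans (hdvd E hES))
      exact h i (hi.trans (hdvd d hd))
  obtain ⟨n, rfl⟩ := hgk
  rw [mul_comm]
  exact hmul n g hgS

theorem exists_blowUp_pair {k : ℕ} (hk : 2 ≤ k) :
    ∃ u, 0 < u ∧ k ∣ u ∧ BlowUp k u (k - 1) ∧ BlowUp k (u + 1) (k - 1) := by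
  obtain ⟨Q, hQ⟩ := exists_blowUp_of_isPrimePow hk
  have hf : k * (k - 1) ∣ k.factorial := by
    obtain ⟨j, rfl⟩ : ∃ j, k = j + 2 := ⟨k - 2, by omega⟩
    rw [Nat.factorial_succ, Nat.factorial_succ]
    exact mul_dvd_mul_left _ (dvd_mul_right _ _)
  have hfA : k.factorial ∣ k.factorial ^ k := dvd_pow_self _ (by omega)
  have hA : k.factorial ^ k ≠ 0 := pow_ne_zero _ (Nat.factorial_ne_zero k)
  obtain ⟨t, ht, htmod, hp⟩ := exists_prime_one_add_mul (Q + 1) hA (Nat.factorial_ne_zero k)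
    (Nat.Coprime.coprime_dvd_right hfA (Nat.coprime_add_self_left.2 (Nat.coprime_one_left _)))
  obtain ⟨s, hs⟩ := hf.trans hfA
  have hs0 : 0 < s := Nat.pos_of_ne_zero fun h => hA (by rw [hs, h, mul_zero])
  have hr : (k - 1) * (k * (s * t)) = k.factorial ^ k * t := by rw [hs]; ring
  have hle : t ≤ k * (s * t) := by
    rw [← mul_assoc]
    exact Nat.le_mul_of_pos_left _ (Nat.mul_pos (by omega) hs0)
  obtain ⟨h1, h2⟩ := hQ (k * (s * t)) (dvd_mul_right _ _)
    (by rw [hr, add_comm]; exact hp.isPrimePow) (by omega)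
  refine ⟨k * (k * (s * t)), Nat.mul_pos (by omega) (by omega), dvd_mul_right _ _, ?_, h2⟩
  refine BlowUp.fill ?_ h1
  rw [mul_comm (k * (s * t)), hr]
  refine (BlowUp.of_pow k (Nat.factorial_ne_zero k)).mul (BlowUp.of_coprime (by omega) ?_)
  exact (htmod.gcd_eq).trans (Nat.gcd_one_left _)

theorem exists_uniform_group_size {k w : ℕ} (hk : 2 ≤ k) (hw : 2 ≤ w) :
    ∃ E, E ≠ 0 ∧ k ∣ E ∧ BlowUp k E (k - 1) ∧ ∀ m, w ≤ m → BlowUp w m E := by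
  obtain ⟨Q, hQ⟩ := exists_blowUp_of_isPrimePow hk
  obtain ⟨D, hD, hm⟩ := BlowUp.exists_forall_of_le hw
  set N := w.factorial * k
  have hN : N ≠ 0 := mul_ne_zero (Nat.factorial_ne_zero w) (by omega)
  have hNp : N ∣ N ^ w := dvd_pow_self _ (by omega)
  set D₁ := D * N ^ w
  have hD₁ : D₁ ≠ 0 := mul_ne_zero hD (pow_ne_zero _ hN)
  have hND₁ : N ∣ D₁ := hNp.trans (dvd_mul_left _ _)
  obtain ⟨t, ht, htmod, hp⟩ := exists_prime_one_add_mul (X := (k - 1) * D₁) (Q + 1)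
    (mul_ne_zero (by omega) hD₁) (Nat.factorial_ne_zero w)
    (Nat.Coprime.coprime_dvd_right (((dvd_mul_right _ _).trans hND₁).trans (dvd_mul_left _ _))
      (Nat.coprime_add_self_left.2 (Nat.coprime_one_left _)))
  have hkE : k ∣ D₁ * t := ((dvd_mul_left k _).trans hND₁).trans (dvd_mul_right _ _)
  have hle : t ≤ D₁ * t := Nat.le_mul_of_pos_left _ (Nat.pos_of_ne_zero hD₁)
  refine ⟨D₁ * t, by omega, hkE, (hQ _ hkE ?_ (by omega)).1, fun m hwm => ?_⟩
  · rw [← mul_assoc, add_comm]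
    exact hp.isPrimePow
  · exact ((hm m hwm).mul (BlowUp.of_pow w hN)).mul
      (BlowUp.of_coprime (by omega) ((htmod.gcd_eq).trans (Nat.gcd_one_left _)))

/-- All sufficiently large `r` congruent to `c` modulo `E` are numbers of groups of a uniform design
with block size `k` and group size `k - 1`. -/
def CompleteMod (k E c : ℕ) : Prop :=
  ∃ N, ∀ r, N ≤ r → r ≡ c [MOD E] → BlowUp k r (k - 1)

namespace CompleteMod

variable {k u E c d : ℕ}

theorem congr (h : CompleteMod k E c) (hcd : c ≡ d [MOD E]) : CompleteMod k E d := by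
  obtain ⟨N, hN⟩ := h
  exact ⟨N, fun r hr hrd => hN r hr (hrd.trans hcd.symm)⟩

theorem exists_ge (hE : E ≠ 0) (c N : ℕ) : ∃ r, N ≤ r ∧ r ≡ c [MOD E] := by
  obtain ⟨r, h1, -, h2⟩ := exists_modEq_mem_Ico hE c N
  exact ⟨r, h1, h2⟩

theorem of_blowUp {s : ℕ} (hE0 : E ≠ 0) (hu : BlowUp k u (k - 1)) (hu1 : BlowUp k (u + 1) (k - 1))
    (hRE : BlowUp k E (k - 1)) (hE : ∀ m, u + 1 ≤ m → BlowUp (u + 1) m E)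
    (hs : BlowUp k s (k - 1)) : CompleteMod k E s := by
  have hmulE : ∀ x, u ≤ x → BlowUp k (E * x) (k - 1) := fun x hx => by
    have := (hE (x + 1) (by omega)).truncate (Nat.zero_le E) hu hu1 hRE (BlowUp.zero k (k - 1))
    rwa [add_zero, mul_comm] at this
  set f := (u + 1).factorial
  have hf : 0 < f := Nat.factorial_pos _
  have hbig : ∀ x s' m, x.Coprime f → u + 1 ≤ x → u ≤ m → s' ≤ E * x → BlowUp k s' (k - 1) →
      BlowUp k (m * (E * x) + s') (k - 1) := fun x s' m hxf hx hm hsx hs' =>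
    ((hE (m + 1) (by omega)).mul (BlowUp.of_coprime (by omega) hxf)).truncate hsx hu hu1
      (hmulE x (by omega)) hs'
  obtain ⟨x, hxs, hxf⟩ := exists_ge hf.ne' 1 (s + u + 1)
  have hxf' : x.Coprime f := hxf.gcd_eq.trans (Nat.gcd_one_left _)
  have hsx : s ≤ E * x := (by omega : s ≤ x).trans (Nat.le_mul_of_pos_left x (by omega))
  set m := 1 + x * (u + 1) with hm
  set P := x * f with hP
  have hP0 : P ≠ 0 := mul_ne_zero (by omega) hf.ne'
  have hum : u ≤ m := by nlinarith
  have key : ∀ y, m * s + m * (m + 1) * (P + 1) + (m + 1) * (x * (u + 1)) + m * (u + 1) ≤ y →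
      BlowUp k (s + E * y) (k - 1) := by
    intro y hy
    obtain ⟨z₀, hz₀f, hz₀x⟩ := Nat.chineseRemainder hxf'.symm 1 y
    obtain ⟨x', hx'1, hx'2, hx'3⟩ := exists_modEq_mem_Ico hP0 z₀ ((y + s) / (m + 1) + 1)
    have hx'f : x' ≡ 1 [MOD f] := (hx'3.of_mul_left x).trans hz₀f
    have hx'x : x' ≡ y [MOD x] := (hx'3.of_mul_right f).trans hz₀x
    have hlow : y + s ≤ (m + 1) * x' := by
      have := Nat.lt_mul_div_succ (y + s) (Nat.succ_pos m)
      exact this.le.trans (Nat.mul_le_mul_left _ hx'1)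
    have hhigh : (m + 1) * x' ≤ y + s + (m + 1) * (P + 1) := by
      have h1 := Nat.mul_div_le (y + s) (m + 1)
      have h2 : (m + 1) * x' ≤ (m + 1) * ((y + s) / (m + 1) + (P + 1)) :=
        Nat.mul_le_mul_left _ (by omega)
      rw [mul_add] at h2
      omega
    have hmx : m * x' + x * (u + 1) ≤ y := by
      refine Nat.le_of_mul_le_mul_left (?_ : (m + 1) * _ ≤ (m + 1) * _) (Nat.succ_pos m)
      have := Nat.mul_le_mul_left m hhigh
      nlinarith
    have hmod : m * x' ≡ y [MOD x] := by
      have h1 : m ≡ 1 [MOD x] := by simp [hm, Nat.ModEq]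
      simpa using h1.mul hx'x
    obtain ⟨z, hz⟩ := (Nat.modEq_iff_dvd' (by omega)).1 hmod
    have hy' : y = m * x' + x * z := by omega
    have hz1 : u ≤ z := by
      have h1 : x * (u + 1) ≤ x * z := by omega
      have := Nat.le_of_mul_le_mul_left h1 (by omega)
      omega
    have hx'u : u + 1 ≤ x' := by
      by_contra hlt
      have : (m + 1) * x' ≤ (m + 1) * u := Nat.mul_le_mul_left _ (by omega)
      nlinarith
    have hs' : BlowUp k (z * (E * x) + s) (k - 1) :=
      hbig x s z hxf' (by omega) hz1 hsx hs
    have h3 := hbig x' (z * (E * x) + s) m (hx'f.gcd_eq.trans (Nat.gcd_one_left _)) hx'u hum ?_ hs'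
    · convert h3 using 1
      rw [hy']
      ring
    · have h4 : x * z + s ≤ x' := by
        rw [hy', Nat.succ_mul] at hlow
        omega
      have h5 : s ≤ E * s := Nat.le_mul_of_pos_left s (by omega)
      have h6 := Nat.mul_le_mul_left E h4
      nlinarith
  refine ⟨s + E * (m * s + m * (m + 1) * (P + 1) + (m + 1) * (x * (u + 1)) + m * (u + 1)),
    fun r hr hrs => ?_⟩
  obtain ⟨y, hy⟩ := (Nat.modEq_iff_dvd' ((Nat.le_add_right _ _).trans hr)).1 hrs.symm
  obtain rfl : r = s + E * y := by
    have := (Nat.le_add_right _ _).trans hr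
    omega
  exact key y (Nat.le_of_mul_le_mul_left (Nat.le_of_add_le_add_left hr) (by omega))

theorem add (hE : E ≠ 0) (hone : CompleteMod k E 1) (hc : CompleteMod k E c)
    (hd : CompleteMod k E d) (hd1 : CompleteMod k E (d + 1)) : CompleteMod k E (c + d) := by
  obtain ⟨N₁, hN₁⟩ := hone
  obtain ⟨Nc, hNc⟩ := hc
  obtain ⟨Nd, hNd⟩ := hd
  obtain ⟨Nd', hNd'⟩ := hd1
  obtain ⟨u, hu, hud⟩ := exists_ge hE d (Nd + Nd' + 1)
  set f := (u + 1).factorial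
  set F := E * f
  have hF : 0 < F := Nat.mul_pos (by omega) (Nat.factorial_pos _)
  have huF : 0 < u * F := Nat.mul_pos (by omega) hF
  refine ⟨Nc + u + u * F * (Nc + u + N₁), fun r hr hrcd => ?_⟩
  set j := (r - (Nc + u)) / (u * F)
  have hj1 : u * F * j ≤ r - (Nc + u) := Nat.mul_div_le _ _
  have hj2 : r - (Nc + u) < u * F * (j + 1) := Nat.lt_mul_div_succ _ huF
  have hj3 : Nc + u + N₁ ≤ j := (Nat.le_div_iff_mul_le huF).2 (by rw [mul_comm]; omega)
  have hFj : F * (Nc + u) ≤ F * j := Nat.mul_le_mul_left F (by omega)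
  have hFc : Nc ≤ F * Nc := Nat.le_mul_of_pos_left _ hF
  have hjF : j ≤ F * j := Nat.le_mul_of_pos_left _ hF
  set t := 1 + F * j with ht
  have hut : u * t = u + u * F * j := by rw [ht]; ring
  have hFu : F * u = u * F := mul_comm _ _
  have htE : t ≡ 1 [MOD E] := by simp [ht, F, Nat.ModEq, mul_assoc]
  have htf : t.Coprime f := by
    have : t ≡ 1 [MOD f] := by simp [ht, F, Nat.ModEq, mul_assoc, mul_left_comm E f]
    exact this.gcd_eq.trans (Nat.gcd_one_left _)
  have hsum : u * t + (r - u * t) = r := Nat.add_sub_cancel' (by omega)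
  rw [← hsum]
  refine (BlowUp.of_coprime (by omega) htf).truncate ?_ (hNd u (by omega) hud)
    (hNd' (u + 1) (by omega) (hud.add_right 1)) (hN₁ t (by omega) htE) (hNc _ (by omega) ?_)
  · rw [mul_add, mul_one] at hj2
    rw [mul_add] at hFj
    omega
  · refine Nat.ModEq.add_left_cancel (a := u * t) (b := d) (by simpa using hud.mul htE) ?_
    rw [hsum, add_comm d]
    exact hrcd

end CompleteMod

theorem coprime_one_add_of_ordCompl_dvd {p E Y : ℕ} (hp : p ∣ Y) (hE : ordCompl[p] E ∣ Y) :
    (1 + Y).Coprime E := by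
  have hY : (1 + Y).Coprime Y := Nat.coprime_add_self_left.2 (Nat.coprime_one_left _)
  have h : (1 + Y).Coprime (ordProj[p] E * ordCompl[p] E) :=
    Nat.Coprime.mul_right ((Nat.Coprime.coprime_dvd_right hp hY).pow_right _)
      (Nat.Coprime.coprime_dvd_right hE hY)
  rwa [Nat.ordProj_mul_ordCompl_eq_self] at h

theorem exists_modulus {k : ℕ} (hk : 2 ≤ k) :
    ∃ E, E ≠ 0 ∧ k ∣ E ∧ ∀ s, BlowUp k s (k - 1) → CompleteMod k E s := by
  obtain ⟨u, hu0, -, hu, hu1⟩ := exists_blowUp_pair hk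
  obtain ⟨E, hE0, hkE, hRE, hE⟩ := exists_uniform_group_size hk (by omega : 2 ≤ u + 1)
  exact ⟨E, hE0, hkE, fun s hs => CompleteMod.of_blowUp hE0 hu hu1 hRE hE hs⟩

section Residues

variable {k E : ℕ}

theorem CompleteMod.of_coprime {c : ℕ} (hk : 2 ≤ k) (hE0 : E ≠ 0) (hkE : k ∣ E)
    (hE : ∀ s, BlowUp k s (k - 1) → CompleteMod k E s) (hc : k ∣ c)
    (hcop : (1 + (k - 1) * c).Coprime ((k - 1) * E)) : CompleteMod k E c := by
  obtain ⟨Q, hQ⟩ := exists_blowUp_of_isPrimePow hk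
  have hk1 : k - 1 ≠ 0 := by omega
  obtain ⟨q, hq, hqp, hqmod⟩ := Nat.forall_exists_prime_gt_and_modEq (1 + (k - 1) * Q)
    (mul_ne_zero hk1 hE0) hcop
  have h1 : k - 1 ∣ q - 1 := by
    refine (Nat.modEq_iff_dvd' (by omega)).1 ?_
    have := (hqmod.of_mul_right E).symm
    rwa [Nat.ModEq, Nat.add_mul_mod_self_left] at this
  obtain ⟨r, hr⟩ := h1
  obtain rfl : q = 1 + (k - 1) * r := by omega
  have hrc : r ≡ c [MOD E] := Nat.ModEq.mul_left_cancel' hk1 (Nat.ModEq.add_left_cancel' 1 hqmod)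
  have hQr : Q ≤ r := (Nat.lt_of_mul_lt_mul_left (Nat.lt_of_add_lt_add_left hq)).le
  have hkr : k ∣ r := (hrc.dvd_iff hkE).2 hc
  exact (hE r (hQ r hkr (by rw [add_comm]; exact hqp.isPrimePow) hQr).1).congr hrc

/-- Near every prime there is a pair of consecutive complete residues whose valuation is at most
that of `k`. -/
theorem exists_completeMod_pair (hk : 2 ≤ k) (hE0 : E ≠ 0) (hkE : k ∣ E)
    (hE : ∀ s, BlowUp k s (k - 1) → CompleteMod k E s) {p : ℕ} (hp : p.Prime) (hpE : p ∣ E) :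
    ∃ d, (CompleteMod k E d ∧ CompleteMod k E (d + 1)) ∧ ∀ i, p ^ i ∣ d → p ^ i ∣ k := by
  obtain ⟨Q, hQ⟩ := exists_blowUp_of_isPrimePow hk
  have hk1 : k - 1 ≠ 0 := by omega
  have hkk : k.Coprime (k - 1) := by
    have : (k - 1 + 1).Coprime (k - 1) := by simp
    rwa [Nat.sub_add_cancel (by omega)] at this
  set E' := ordCompl[p] E with hE'
  have hE'0 : E' ≠ 0 := (Nat.ordCompl_pos p hE0).ne'
  have hpE' : ¬ p ∣ E' := Nat.not_dvd_ordCompl hp hE0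
  have hcommon : ∀ r, k ∣ r → IsPrimePow ((k - 1) * r + 1) → Q ≤ r →
      (1 + (k - 1) * (k * r)).Coprime ((k - 1) * E) →
      CompleteMod k E (k * r) ∧ CompleteMod k E (k * r + 1) := fun r hkr hpp hr hcop =>
    ⟨CompleteMod.of_coprime hk hE0 hkE hE (dvd_mul_right _ _) hcop, hE _ (hQ r hkr hpp hr).2⟩
  have hcopk : ∀ Y, (1 + (k - 1) * Y).Coprime (k - 1) := fun Y => by simp
  have hndvd : ∀ d, ¬ p ∣ d → ∀ i, p ^ i ∣ d → p ^ i ∣ k := by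
    intro d hd i hi
    rcases Nat.eq_zero_or_pos i with rfl | hi0
    · simp
    · exact absurd ((dvd_pow_self p hi0.ne').trans hi) hd
  by_cases hpk : p ∣ k * (k - 1)
  · have hX : k * (k - 1) * E' ≠ 0 := mul_ne_zero (mul_ne_zero (by omega) hk1) hE'0
    obtain ⟨t, ht, htmod, hq⟩ := exists_prime_one_add_mul (Q + 1) hX hE0
      (coprime_one_add_of_ordCompl_dvd (hpk.trans (dvd_mul_right _ _)) (dvd_mul_left _ _))
    have hpt : ¬ p ∣ t := by
      rw [(htmod.of_dvd hpE).dvd_iff dvd_rfl]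
      exact hp.one_lt.ne' ∘ Nat.dvd_one.1
    set r := k * (E' * t) with hr
    have hqr : 1 + k * (k - 1) * E' * t = (k - 1) * r + 1 := by rw [hr]; ring
    rw [hqr] at hq
    have htr : t ≤ r := by
      rw [hr, ← mul_assoc]
      exact Nat.le_mul_of_pos_left _ (Nat.mul_pos (by omega) (Nat.pos_of_ne_zero hE'0))
    have hkr : k ∣ r := dvd_mul_right _ _
    have hE'r : E' ∣ r := (dvd_mul_right E' t).trans (dvd_mul_left _ _)
    rcases (Nat.Prime.dvd_mul hp).1 hpk with hpk | hpk
    · have hr1 : 2 ≤ r := hk.trans (Nat.le_of_dvd (by omega) hkr)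
      set lam := r * (r - 1) with hlam
      have hlam0 : lam ≠ 0 := mul_ne_zero (by omega) (by omega)
      have hrl : r ∣ lam := dvd_mul_right _ _
      obtain ⟨Q', hQ'⟩ := exists_blowUp_of_prime r
      obtain ⟨t', ht', ht'mod, hq'⟩ := exists_prime_one_add_mul Q' hlam0 hE0
        (coprime_one_add_of_ordCompl_dvd ((hpk.trans hkr).trans hrl) (hE'r.trans hrl))
      refine ⟨lam, ⟨CompleteMod.of_coprime hk hE0 hkE hE (hkr.trans hrl)
        (Nat.Coprime.mul_right (hcopk _) (coprime_one_add_of_ordCompl_dvd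
          (((hpk.trans hkr).trans hrl).trans (dvd_mul_left _ _))
          ((hE'r.trans hrl).trans (dvd_mul_left _ _)))), ?_⟩, fun i hi => ?_⟩
      · have h1 := hQ' _ hq'
          (ht'.trans ((Nat.le_mul_of_pos_left t' (Nat.pos_of_ne_zero hlam0)).trans (by omega)))
          (by simp [hlam, Nat.ModEq]) k (k - 1) (hQ r hkr hq.isPrimePow (by omega)).1
        refine (hE _ h1).congr ?_
        rw [add_comm]
        simpa using (ht'mod.mul_left lam).add_right 1
      · have h1 : (p ^ i).Coprime (E' * t * (r - 1)) := by
          refine Nat.Coprime.pow_left i ((Nat.Prime.coprime_iff_not_dvd hp).2 fun h => ?_)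
          rcases (Nat.Prime.dvd_mul hp).1 h with h | h
          · exact ((Nat.Prime.dvd_mul hp).1 h).elim hpE' hpt
          · have := (Nat.dvd_sub_iff_right (by omega : 1 ≤ r) (hpk.trans hkr)).1 h
            exact hp.one_lt.ne' (Nat.dvd_one.1 this)
        refine h1.dvd_of_dvd_mul_right ?_
        have : lam = k * (E' * t * (r - 1)) := by rw [hlam, hr]; ring
        rwa [← this]
    · refine ⟨k * r, hcommon r hkr hq.isPrimePow (by omega) (Nat.Coprime.mul_right (hcopk _)
        (coprime_one_add_of_ordCompl_dvd (hpk.trans (dvd_mul_right _ _))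
          ((hE'r.trans (dvd_mul_left _ _)).trans (dvd_mul_left _ _)))), hndvd _ fun h => ?_⟩
      have hpk' : ¬ p ∣ k := fun h => Nat.not_coprime_of_dvd_of_dvd hp.one_lt h hpk hkk
      rw [hr, hp.dvd_mul, hp.dvd_mul, hp.dvd_mul] at h
      tauto
  · have hpk1 : ¬ p ∣ k := fun h => hpk (h.trans (dvd_mul_right _ _))
    have hpk2 : ¬ p ∣ k - 1 := fun h => hpk (h.trans (dvd_mul_left _ _))
    set X := (k - 1) * k * E' with hX
    have hX0 : X ≠ 0 := mul_ne_zero (mul_ne_zero hk1 (by omega)) hE'0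
    have hpX : p.Coprime X := by
      rw [hp.coprime_iff_not_dvd, hX, hp.dvd_mul, hp.dvd_mul]
      tauto
    set f := X.totient * ((k - 1) * Q + 1) with hf
    have hf0 : (k - 1) * Q + 1 ≤ f :=
      Nat.le_mul_of_pos_left _ (Nat.totient_pos.2 (Nat.pos_of_ne_zero hX0))
    have hfp : f < p ^ f := Nat.lt_pow_self hp.one_lt
    have hmod : p ^ f ≡ 1 [MOD X] := by
      rw [hf, pow_mul]
      simpa using (Nat.ModEq.pow_totient hpX).pow ((k - 1) * Q + 1)
    obtain ⟨y, hy⟩ := (Nat.modEq_iff_dvd' (by omega)).1 hmod.symm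
    set r := k * (E' * y) with hr
    have hqr : p ^ f = (k - 1) * r + 1 := by
      have : X * y = (k - 1) * r := by rw [hX, hr]; ring
      omega
    have hkr : k ∣ r := dvd_mul_right _ _
    have hE'r : E' ∣ r := (dvd_mul_right E' y).trans (dvd_mul_left _ _)
    have hpr : ¬ p ∣ (k - 1) * r := by
      intro h
      have h1 : p ∣ (k - 1) * r + 1 := by
        rw [← hqr]
        exact dvd_pow_self p (by omega)
      exact hp.one_lt.ne' (Nat.dvd_one.1 ((Nat.dvd_add_right h).1 h1))
    refine ⟨k * r, hcommon r hkr ?_ ?_ (Nat.Coprime.mul_right (hcopk _) ?_), hndvd _ fun h => ?_⟩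
    · rw [← hqr]
      exact hp.isPrimePow.pow (by omega)
    · exact Nat.le_of_mul_le_mul_left (by omega : (k - 1) * Q ≤ (k - 1) * r) (by omega)
    · have h1 : (1 + (k - 1) * (k * r)).Coprime (ordProj[p] E * ordCompl[p] E) := by
        refine Nat.Coprime.mul_right (Nat.Coprime.pow_right _ ?_) ?_
        · rw [Nat.coprime_comm, hp.coprime_iff_not_dvd]
          intro h
          have h2 : p ∣ k * p ^ f := (dvd_pow_self p (by omega)).trans (dvd_mul_left _ _)
          have h3 : k * p ^ f = (1 + (k - 1) * (k * r)) + (k - 1) := by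
            rw [hqr, mul_add, mul_one, mul_left_comm]
            omega
          rw [h3] at h2
          exact hpk2 ((Nat.dvd_add_right h).1 h2)
        · refine Nat.Coprime.coprime_dvd_right
            ((hE'r.trans (dvd_mul_left r k)).trans (dvd_mul_left _ (k - 1))) ?_
          exact Nat.coprime_add_self_left.2 (Nat.coprime_one_left _)
      rwa [Nat.ordProj_mul_ordCompl_eq_self] at h1
    · rw [hp.dvd_mul] at h
      rcases h with h | h
      · exact hpk1 h
      · exact hpr (h.trans (dvd_mul_left _ _))

end Residues

/-- Eventually, every admissible number of groups of size `k - 1` is attained. -/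
theorem exists_forall_blowUp {k : ℕ} (hk : 2 ≤ k) :
    ∃ N, ∀ n, N ≤ k * n → BlowUp k (k * n) (k - 1) ∧ BlowUp k (k * n + 1) (k - 1) := by
  obtain ⟨E, hE0, hkE, hE⟩ := exists_modulus hk
  have hone : CompleteMod k E 1 := hE 1 (BlowUp.one _ _)
  have hzero : CompleteMod k E 0 ∧ CompleteMod k E (0 + 1) := ⟨hE 0 (BlowUp.zero _ _), hone⟩
  have hadd : ∀ a, CompleteMod k E a ∧ CompleteMod k E (a + 1) → ∀ b,
      CompleteMod k E b ∧ CompleteMod k E (b + 1) →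
      CompleteMod k E (a + b) ∧ CompleteMod k E (a + b + 1) := by
    intro a ha b hb
    refine ⟨CompleteMod.add hE0 hone ha.1 hb.1 hb.2, ?_⟩
    rw [add_right_comm]
    exact CompleteMod.add hE0 hone ha.2 hb.1 hb.2
  have hkS : CompleteMod k E k ∧ CompleteMod k E (k + 1) :=
    mem_of_forall_prime (S := {d | CompleteMod k E d ∧ CompleteMod k E (d + 1)}) hE0 hzero hadd
      (fun a b hab h => ⟨h.1.congr hab, h.2.congr (hab.add_right 1)⟩)
      fun p hp hpE => exists_completeMod_pair hk hE0 hkE hE hp hpE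
  have hmul : ∀ n, CompleteMod k E (k * n) ∧ CompleteMod k E (k * n + 1) := by
    intro n
    induction n with
    | zero => exact hzero
    | succ n ih => exact hadd _ ih _ hkS
  choose N hN using fun n => (hmul n).1
  choose N' hN' using fun n => (hmul n).2
  refine ⟨∑ i ∈ Finset.range E, (N i + N' i), fun n hn => ?_⟩
  have hle : N (n % E) + N' (n % E) ≤ k * n :=
    (Finset.single_le_sum (f := fun i => N i + N' i) (fun _ _ => Nat.zero_le _)
      (Finset.mem_range.2 (Nat.mod_lt n (Nat.pos_of_ne_zero hE0)))).trans hn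
  have hmod : k * n ≡ k * (n % E) [MOD E] := (Nat.mod_modEq n E).symm.mul_left k
  exact ⟨hN _ _ (by omega) hmod, hN' _ _ (by omega) (hmod.add_right 1)⟩

theorem exists_forall_design {k : ℕ} (hk : 2 ≤ k) :
    ∃ N, ∀ n, N ≤ n → (n ≡ 1 [MOD k * (k - 1)] ∨ n ≡ k [MOD k * (k - 1)]) →
      HasGDD {k} (id : Fin n → Fin n) := by
  obtain ⟨N, hN⟩ := exists_forall_blowUp hk
  refine ⟨(k - 1) * N + k, fun n hn hmod => ?_⟩
  have hle : ∀ s, n ≤ (k - 1) * (k * s) + k → N ≤ k * s := fun s hs =>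
    Nat.le_of_mul_le_mul_left (by omega : (k - 1) * N ≤ (k - 1) * (k * s)) (by omega)
  rcases hmod with hmod | hmod
  · obtain ⟨s, hs⟩ := (Nat.modEq_iff_dvd' (by omega)).1 hmod.symm
    have h1 : k * (k - 1) * s = (k - 1) * (k * s) := by ring
    obtain rfl : n = (k - 1) * (k * s) + 1 := by omega
    exact (BlowUp.iff_design hk).1 (hN s (hle s (by omega))).1
  · obtain ⟨s, hs⟩ := (Nat.modEq_iff_dvd' (by omega)).1 hmod.symm
    have h1 : k * (k - 1) * s = (k - 1) * (k * s) := by ring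
    obtain rfl : n = (k - 1) * (k * s + 1) + 1 := by
      rw [mul_add, mul_one]
      omega
    refine (BlowUp.iff_design hk).1 (hN s (hle s ?_)).2
    rw [mul_add, mul_one]
    omega

/-- Wilson: for every `k ≥ 2` there is an `N` such that for all
`n ≥ N` with `n ≡ 1` or `n ≡ k (mod k(k-1))`, the edge set of `K_n` can be
partitioned into edge sets of k-cliques, i.e. `K_n` has a perfect k-clique
packing (equivalently, an `(n,k,1)`-BIBD exists). -/
theorem exists_perfect_clique_packing (k : ℕ) (hk : 2 ≤ k) :
    ∃ N : ℕ, ∀ n ≥ N,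
      (n ≡ 1 [MOD k * (k - 1)] ∨ n ≡ k [MOD k * (k - 1)]) →
      ∃ P : Finset (Finset (Fin n)),
        (∀ s ∈ P, (⊤ : SimpleGraph (Fin n)).IsNClique k s) ∧
        ∀ e ∈ (⊤ : SimpleGraph (Fin n)).edgeFinset,
          ∃! s, s ∈ P ∧ e ∈ cliqueEdges (⊤ : SimpleGraph (Fin n)) s := by
  obtain ⟨N, hN⟩ := exists_forall_design hk
  refine ⟨N, fun n hn hmod => ?_⟩
  obtain ⟨ι, B, hcard, -, hB⟩ := hN n hn hmod
  refine ⟨Finset.univ.filter fun s => ∃ i, B i = s, fun s hs => ?_, fun e he => ?_⟩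
  · obtain ⟨i, rfl⟩ := (Finset.mem_filter.1 hs).2
    exact ⟨fun x _ y _ hxy => hxy, hcard i⟩
  · induction e with | h x y => ?_
    have hxy : x ≠ y := by simpa using he
    have hmem : ∀ s : Finset (Fin n),
        s(x, y) ∈ cliqueEdges (⊤ : SimpleGraph (Fin n)) s ↔ x ∈ s ∧ y ∈ s := fun s => by
      simp [cliqueEdges, hxy]
    obtain ⟨i, hi, huniq⟩ := hB x y hxy
    refine ⟨B i, ⟨Finset.mem_filter.2 ⟨Finset.mem_univ _, i, rfl⟩, (hmem _).2 hi⟩, ?_⟩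
    rintro s ⟨hs, hes⟩
    obtain ⟨j, rfl⟩ := (Finset.mem_filter.1 hs).2
    rw [huniq j ((hmem _).1 hes)]
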